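/- arXiv:2307.14513 — 4 statements merged into one kernel-verified Lean document; each statement's English description precedes it below -/
import Mathlib

section
/- Let $(R,\mathfrak{m})$ be a commutative Noetherian complete local ring, $I$ an ideal of $R$, and $M$ a non-zero $I$-cofinite $R$-module. Then $\dim R/(I+\operatorname{Ann}_R M) = \dim_R M$. -/
open CategoryTheory

noncomputable section

/-- The Krull dimension of an `R`-module `M`: the supremum of `dim R/𝔭` over
the primes `𝔭` in the support of `M`. -/
def moduleDim (R : Type) [CommRing R] (M : Type) [AddCommGroup M] [Module R M] :
    WithBot ℕ∞ :=
  ⨆ p ∈ Module.support R M, ringKrullDim (R ⧸ p.asIdeal)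

/-- An `R`-module `M` is `I`-cofinite if `Supp M ⊆ V(I)` and `Ext^i_R(R/I, M)` is a finitely
generated `R`-module for all `i ≥ 0`. -/
def IsCofinite (R : Type) [CommRing R] (I : Ideal R) (M : Type) [AddCommGroup M]
    [Module R M] : Prop :=
  Module.support R M ⊆ PrimeSpectrum.zeroLocus (I : Set R) ∧
    ∀ i : ℕ, Module.Finite R
      (((Ext R (ModuleCat.{0} R) i).obj (Opposite.op (ModuleCat.of R (R ⧸ I)))).obj
        (ModuleCat.of R M))


universe u v

namespace Differential

section Cone

variable {R : Type u} [CommRing R] {V : Type v} [AddCommGroup V] [Module R V]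

/-- The homology of the differential `d` is a finitely generated module. -/
def FiniteHomology (d : V →ₗ[R] V) : Prop :=
  ((LinearMap.ker d).map (LinearMap.range d).mkQ).FG

/-- Every homology class of `d` is killed by an element outside `p`. -/
def HomologyVanishesAt (p : Ideal R) (d : V →ₗ[R] V) : Prop :=
  ∀ v, d v = 0 → ∃ s ∉ p, ∃ w, s • v = d w

/-- The element `s` annihilates the homology of `d`. -/
def KillsHomology (s : R) (d : V →ₗ[R] V) : Prop :=
  ∀ v, d v = 0 → ∃ w, s • v = d w

/-- The differential of the (shifted) mapping cone of an endomorphism `φ`. -/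
def cone (d φ : V →ₗ[R] V) : V × V →ₗ[R] V × V :=
  (d ∘ₗ LinearMap.fst R V V).prod (φ ∘ₗ LinearMap.fst R V V - d ∘ₗ LinearMap.snd R V V)

@[simp]
lemma cone_apply (d φ : V →ₗ[R] V) (v : V × V) : cone d φ v = (d v.1, φ v.1 - d v.2) := rfl

lemma cone_cone (d φ : V →ₗ[R] V) (hd : ∀ v, d (d v) = 0) (hφ : ∀ v, d (φ v) = φ (d v))
    (v : V × V) : cone d φ (cone d φ v) = 0 := by
  simp [hd, hφ]

/-- The Koszul differential: the cone of multiplication by `a`. -/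
def koszulStep (a : R) (d : V →ₗ[R] V) : V × V →ₗ[R] V × V :=
  cone d (a • LinearMap.id)

@[simp]
lemma koszulStep_apply (a : R) (d : V →ₗ[R] V) (v : V × V) :
    koszulStep a d v = (d v.1, a • v.1 - d v.2) := rfl

/-- Multiplication by the variable on power series with coefficients in `V`. -/
def shiftUp (R : Type u) [CommRing R] (V : Type v) [AddCommGroup V] [Module R V] :
    (ℕ → V) →ₗ[R] (ℕ → V) where
  toFun f n := Nat.casesOn n 0 f
  map_add' f g := by ext n; cases n <;> simp
  map_smul' r f := by ext n; cases n <;> simp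

@[simp]
lemma shiftUp_zero (f : ℕ → V) : shiftUp R V f 0 = 0 := rfl

@[simp]
lemma shiftUp_succ (f : ℕ → V) (n : ℕ) : shiftUp R V f (n + 1) = f n := rfl

/-- Multiplication by the variable on polynomials in the inverse of that variable. -/
def shiftDown (R : Type u) [CommRing R] (V : Type v) [AddCommGroup V] [Module R V] :
    (ℕ →₀ V) →ₗ[R] (ℕ →₀ V) where
  toFun f := f.comapDomain Nat.succ (Nat.succ_injective.injOn)
  map_add' f g := by ext n; simp
  map_smul' r f := by ext n; simp

@[simp]
lemma shiftDown_apply (f : ℕ →₀ V) (n : ℕ) : shiftDown R V f n = f (n + 1) := rfl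

/-- The differential of the derived completion at `a`: the cone of `a - x` on power series. -/
def completionStep (a : R) (d : V →ₗ[R] V) : (ℕ → V) × (ℕ → V) →ₗ[R] (ℕ → V) × (ℕ → V) :=
  cone (d.compLeft ℕ) (a • LinearMap.id - shiftUp R V)

@[simp]
lemma completionStep_fst (a : R) (d : V →ₗ[R] V) (f : (ℕ → V) × (ℕ → V)) (n : ℕ) :
    (completionStep a d f).1 n = d (f.1 n) := rfl

@[simp]
lemma completionStep_snd (a : R) (d : V →ₗ[R] V) (f : (ℕ → V) × (ℕ → V)) (n : ℕ) :
    (completionStep a d f).2 n = a • f.1 n - shiftUp R V f.1 n - d (f.2 n) := rfl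

/-- The differential of the derived torsion at `a`: the cone of `a - x` on polynomials in the
inverse of the variable `x`. -/
def torsionStep (a : R) (d : V →ₗ[R] V) : (ℕ →₀ V) × (ℕ →₀ V) →ₗ[R] (ℕ →₀ V) × (ℕ →₀ V) :=
  cone (Finsupp.mapRange.linearMap d) (a • LinearMap.id - shiftDown R V)

@[simp]
lemma torsionStep_fst (a : R) (d : V →ₗ[R] V) (f : (ℕ →₀ V) × (ℕ →₀ V)) (n : ℕ) :
    (torsionStep a d f).1 n = d (f.1 n) := by
  simp [torsionStep]

@[simp]
lemma torsionStep_snd (a : R) (d : V →ₗ[R] V) (f : (ℕ →₀ V) × (ℕ →₀ V)) (n : ℕ) :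
    (torsionStep a d f).2 n = a • f.1 n - f.1 (n + 1) - d (f.2 n) := by
  simp [torsionStep]

lemma koszulStep_koszulStep (a : R) (d : V →ₗ[R] V) (hd : ∀ v, d (d v) = 0) (v : V × V) :
    koszulStep a d (koszulStep a d v) = 0 :=
  cone_cone d _ hd (by simp) v

lemma completionStep_completionStep (a : R) (d : V →ₗ[R] V) (hd : ∀ v, d (d v) = 0)
    (v : (ℕ → V) × (ℕ → V)) : completionStep a d (completionStep a d v) = 0 :=
  cone_cone _ _ (fun f => by ext n; simp [hd])
    (fun f => by ext n; cases n <;> simp) v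

lemma torsionStep_torsionStep (a : R) (d : V →ₗ[R] V) (hd : ∀ v, d (d v) = 0)
    (v : (ℕ →₀ V) × (ℕ →₀ V)) : torsionStep a d (torsionStep a d v) = 0 :=
  cone_cone _ _ (fun f => by ext n; simp [hd]) (fun f => by ext n; simp) v

end Cone

/-- `dW` is a completed deformation of `dV` along a variable `x` homotopic to `a`. -/
structure Deformation {R : Type u} [CommRing R] (a : R) {W V : Type v} [AddCommGroup W]
    [Module R W] [AddCommGroup V] [Module R V] (dW : W →ₗ[R] W) (dV : V →ₗ[R] V) where
  /-- the variable -/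
  x : W →ₗ[R] W
  /-- the homotopy between the variable and `a` -/
  h : W →ₗ[R] W
  /-- reduction modulo the variable -/
  π : W →ₗ[R] V
  d_x : ∀ w, dW (x w) = x (dW w)
  π_d : ∀ w, π (dW w) = dV (π w)
  x_injective : Function.Injective x
  π_surjective : Function.Surjective π
  π_x : ∀ w, π (x w) = 0
  exists_of_π : ∀ w, π w = 0 → ∃ w', w = x w'
  homotopy : ∀ w, x w = a • w + (dW (h w) + h (dW w))
  complete : ∀ w : ℕ → W, ∃ ω : ℕ → W, ∀ k, ω k = w k + x (ω (k + 1))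
  separated : ∀ y : ℕ → W, (∀ k, y k = x (y (k + 1))) → ∀ k, y k = 0

/-- `dG` is the differential on `U[1/x] / U` induced by `dU`, where `x` is an injective
endomorphism of `U`, and `τ k` is division by `x ^ k`. -/
structure Polarization {R : Type u} [CommRing R] {U G : Type v} [AddCommGroup U]
    [Module R U] [AddCommGroup G] [Module R G] (dU : U →ₗ[R] U) (dG : G →ₗ[R] G) where
  /-- the variable -/
  x : U →ₗ[R] U
  /-- division by powers of the variable -/
  τ : ℕ → U →ₗ[R] G
  d_x : ∀ u, dU (x u) = x (dU u)
  τ_d : ∀ k u, τ k (dU u) = dG (τ k u)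
  x_injective : Function.Injective x
  τ_succ : ∀ k u, τ (k + 1) (x u) = τ k u
  exists_τ : ∀ g, ∃ k u, τ k u = g
  τ_pow : ∀ k u, τ k ((x ^ k) u) = 0
  exists_of_τ : ∀ k u, τ k u = 0 → ∃ u', u = (x ^ k) u'

section Step

variable {R : Type u} [CommRing R] {V : Type v} [AddCommGroup V] [Module R V]

/-- The completion step deforms the Koszul step. -/
def deformationStep (a : R) (d : V →ₗ[R] V) :
    Deformation a (completionStep a d) (koszulStep a d) where
  x := (shiftUp R V).prodMap (shiftUp R V)
  h := -(LinearMap.inl R (ℕ → V) (ℕ → V) ∘ₗ LinearMap.snd R (ℕ → V) (ℕ → V))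
  π := (LinearMap.proj 0).prodMap (LinearMap.proj 0)
  d_x w := by
    ext n <;> cases n <;> simp
  π_d w := by
    ext <;> simp
  x_injective := by
    intro w w' h
    ext n
    · exact congrFun (congrArg Prod.fst h) (n + 1)
    · exact congrFun (congrArg Prod.snd h) (n + 1)
  π_surjective w := ⟨(fun _ => w.1, fun _ => w.2), rfl⟩
  π_x w := rfl
  exists_of_π w hw := ⟨(fun n => w.1 (n + 1), fun n => w.2 (n + 1)), by
    have h1 := congrArg Prod.fst hw
    have h2 := congrArg Prod.snd hw
    ext n <;> cases n
    · exact h1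
    · rfl
    · exact h2
    · rfl⟩
  homotopy w := by
    ext n <;> cases n <;> simp <;> abel
  complete w := by
    have key (w : ℕ → ℕ → V) : ∃ ω : ℕ → ℕ → V, ∀ k, ω k = w k + shiftUp R V (ω (k + 1)) := by
      refine ⟨fun k n => Nat.rec (fun k => w k 0) (fun n ih k => w k (n + 1) + ih (k + 1)) n k, ?_⟩
      intro k
      ext n
      cases n <;> simp
    obtain ⟨ω₁, h₁⟩ := key (fun k => (w k).1)
    obtain ⟨ω₂, h₂⟩ := key (fun k => (w k).2)
    exact ⟨fun k => (ω₁ k, ω₂ k), fun k => Prod.ext (h₁ k) (h₂ k)⟩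
  separated y hy := by
    have key (w : ℕ → ℕ → V) (hw : ∀ k, w k = shiftUp R V (w (k + 1))) (k : ℕ) : w k = 0 := by
      ext n
      induction n generalizing k with
      | zero => rw [hw]; rfl
      | succ n ih => rw [hw]; exact ih (k + 1)
    intro k
    exact Prod.ext (key (fun k => (y k).1) (fun k => congrArg Prod.fst (hy k)) k)
      (key (fun k => (y k).2) (fun k => congrArg Prod.snd (hy k)) k)

variable {W : Type v} [AddCommGroup W] [Module R W]

/-- Deformations are preserved by the Koszul step. -/
def Deformation.koszulStep {a : R} {dW : W →ₗ[R] W} {dV : V →ₗ[R] V} (D : Deformation a dW dV)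
    (b : R) : Deformation a (koszulStep b dW) (koszulStep b dV) where
  x := D.x.prodMap D.x
  h := D.h.prodMap (-D.h)
  π := D.π.prodMap D.π
  d_x w := by simp [D.d_x]
  π_d w := by simp [D.π_d]
  x_injective := D.x_injective.prodMap D.x_injective
  π_surjective := D.π_surjective.prodMap D.π_surjective
  π_x w := by simp [D.π_x]
  exists_of_π w hw := by
    obtain ⟨w₁, h₁⟩ := D.exists_of_π w.1 (congrArg Prod.fst hw)
    obtain ⟨w₂, h₂⟩ := D.exists_of_π w.2 (congrArg Prod.snd hw)
    exact ⟨(w₁, w₂), Prod.ext h₁ h₂⟩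
  homotopy w := by
    refine Prod.ext ?_ ?_
    · simpa using D.homotopy w.1
    · have := D.homotopy w.2
      simp only [LinearMap.prodMap_apply, this]
      simp
      abel
  complete w := by
    obtain ⟨ω₁, h₁⟩ := D.complete (fun k => (w k).1)
    obtain ⟨ω₂, h₂⟩ := D.complete (fun k => (w k).2)
    exact ⟨fun k => (ω₁ k, ω₂ k), fun k => Prod.ext (h₁ k) (h₂ k)⟩
  separated y hy k :=
    Prod.ext (D.separated (fun k => (y k).1) (fun k => congrArg Prod.fst (hy k)) k)
      (D.separated (fun k => (y k).2) (fun k => congrArg Prod.snd (hy k)) k)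

/-- The first `k` coefficients of a power series, as a polynomial in the inverse variable: the
class of the power series divided by the `k`-th power of the variable. -/
def principalPart (R : Type u) [CommRing R] (V : Type v) [AddCommGroup V] [Module R V] (k : ℕ) :
    (ℕ → V) →ₗ[R] (ℕ →₀ V) where
  toFun f := Finsupp.onFinset (Finset.range k) (fun n => if n < k then f (k - 1 - n) else 0)
    (by intro n hn; by_contra h; simp at h; simp [h.not_gt] at hn)
  map_add' f g := by ext n; by_cases h : n < k <;> simp [h]
  map_smul' r f := by ext n; by_cases h : n < k <;> simp [h]

lemma principalPart_apply (k : ℕ) (f : ℕ → V) (n : ℕ) :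
    principalPart R V k f n = if n < k then f (k - 1 - n) else 0 := rfl

lemma principalPart_comp (d : V →ₗ[R] V) (k : ℕ) (f : ℕ → V) (n : ℕ) :
    principalPart R V k (fun i => d (f i)) n = d (principalPart R V k f n) := by
  by_cases h : n < k <;> simp [principalPart_apply, h]

lemma principalPart_shiftUp (k : ℕ) (f : ℕ → V) :
    principalPart R V k (shiftUp R V f) = shiftDown R V (principalPart R V k f) := by
  ext n
  simp only [shiftDown_apply, principalPart_apply]
  by_cases h : n + 1 < k
  · obtain ⟨m, rfl⟩ : ∃ m, k = n + 2 + m := ⟨k - (n + 2), by omega⟩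
    have h1 : n + 2 + m - 1 - n = m + 1 := by omega
    have h2 : n + 2 + m - 1 - (n + 1) = m := by omega
    simp only [h1, h2, shiftUp_succ]
    rw [if_pos (by omega), if_pos (by omega)]
  · rw [if_neg h]
    split_ifs with h'
    · have : k - 1 - n = 0 := by omega
      rw [this, shiftUp_zero]
    · rfl

lemma principalPart_succ_shiftUp (k : ℕ) (f : ℕ → V) :
    principalPart R V (k + 1) (shiftUp R V f) = principalPart R V k f := by
  ext n
  simp only [principalPart_apply]
  by_cases h : n < k
  · have h1 : k + 1 - 1 - n = (k - 1 - n) + 1 := by omega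
    rw [if_pos h, if_pos (by omega), h1, shiftUp_succ]
  · rw [if_neg h]
    split_ifs with h'
    · have : k + 1 - 1 - n = 0 := by omega
      rw [this, shiftUp_zero]
    · rfl

lemma shiftUp_pow_apply (k : ℕ) (f : ℕ → V) (n : ℕ) :
    (shiftUp R V ^ k) f n = if k ≤ n then f (n - k) else 0 := by
  induction k generalizing n with
  | zero => simp
  | succ k ih =>
    rw [pow_succ', Module.End.mul_apply]
    cases n with
    | zero => simp
    | succ n => simp [ih]

lemma exists_principalPart (g : ℕ →₀ V) (k : ℕ) (hk : ∀ n, k ≤ n → g n = 0) :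
    ∃ f, principalPart R V k f = g := by
  refine ⟨fun n => g (k - 1 - n), ?_⟩
  ext n
  rw [principalPart_apply]
  split_ifs with h
  · congr 1
    omega
  · exact (hk n (by omega)).symm

lemma exists_of_principalPart (k : ℕ) (f : ℕ → V) (h : principalPart R V k f = 0) :
    ∃ f', f = (shiftUp R V ^ k) f' := by
  refine ⟨fun n => f (n + k), ?_⟩
  ext n
  rw [shiftUp_pow_apply]
  split_ifs with h'
  · congr 1
    omega
  · have := DFunLike.congr_fun h (k - 1 - n)
    rw [principalPart_apply, if_pos (by omega)] at this
    rw [show n = k - 1 - (k - 1 - n) by omega]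
    exact this

lemma principalPart_shiftUp_pow (k : ℕ) (f : ℕ → V) :
    principalPart R V k ((shiftUp R V ^ k) f) = 0 := by
  ext n
  rw [principalPart_apply]
  split_ifs with h
  · rw [shiftUp_pow_apply, if_neg (by omega)]
    rfl
  · rfl

lemma exists_forall_le_eq_zero (g : ℕ →₀ V) : ∃ k, ∀ n, k ≤ n → g n = 0 := by
  refine ⟨g.support.sup id + 1, fun n hn => ?_⟩
  by_contra h
  have := Finset.le_sup (f := id) (Finsupp.mem_support_iff.mpr h)
  simp only [id] at this
  omega

lemma prodMap_pow (f : V →ₗ[R] V) (k : ℕ) (v : V × V) :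
    ((f.prodMap f) ^ k) v = ((f ^ k) v.1, (f ^ k) v.2) := by
  induction k with
  | zero => rfl
  | succ k ih => simp only [pow_succ', Module.End.mul_apply, ih, LinearMap.prodMap_apply]

/-- The torsion step is the polarization of the completion step. -/
def polarizationStep (a : R) (d : V →ₗ[R] V) :
    Polarization (completionStep a d) (torsionStep a d) where
  x := (shiftUp R V).prodMap (shiftUp R V)
  τ k := (principalPart R V k).prodMap (principalPart R V k)
  d_x := (deformationStep a d).d_x
  x_injective := (deformationStep a d).x_injective
  τ_d k u := by
    refine Prod.ext ?_ ?_
    · ext n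
      exact principalPart_comp (R := R) d k u.1 n
    · ext n
      have h : (completionStep a d u).2 = a • u.1 - shiftUp R V u.1 - fun i => d (u.2 i) := rfl
      rw [LinearMap.prodMap_apply, h, map_sub, map_sub, map_smul, principalPart_shiftUp]
      simp [principalPart_comp]
  τ_succ k u := Prod.ext (principalPart_succ_shiftUp (R := R) k u.1)
    (principalPart_succ_shiftUp (R := R) k u.2)
  exists_τ g := by
    obtain ⟨k₁, h₁⟩ := exists_forall_le_eq_zero g.1
    obtain ⟨k₂, h₂⟩ := exists_forall_le_eq_zero g.2
    obtain ⟨f₁, hf₁⟩ := exists_principalPart (R := R) g.1 (max k₁ k₂) (fun n hn => h₁ n (by omega))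
    obtain ⟨f₂, hf₂⟩ := exists_principalPart (R := R) g.2 (max k₁ k₂) (fun n hn => h₂ n (by omega))
    exact ⟨max k₁ k₂, (f₁, f₂), Prod.ext hf₁ hf₂⟩
  τ_pow k u := by
    rw [prodMap_pow]
    exact Prod.ext (principalPart_shiftUp_pow k u.1) (principalPart_shiftUp_pow k u.2)
  exists_of_τ k u hu := by
    obtain ⟨f₁, h₁⟩ := exists_of_principalPart (R := R) k u.1 (congrArg Prod.fst hu)
    obtain ⟨f₂, h₂⟩ := exists_of_principalPart (R := R) k u.2 (congrArg Prod.snd hu)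
    exact ⟨(f₁, f₂), by rw [prodMap_pow]; exact Prod.ext h₁ h₂⟩

end Step

section Polarization

variable {R : Type u} [CommRing R] {U G : Type v} [AddCommGroup U] [Module R U] [AddCommGroup G]
  [Module R G] {dU : U →ₗ[R] U} {dG : G →ₗ[R] G}

namespace Polarization

lemma τ_add (P : Polarization dU dG) (j k : ℕ) (u : U) :
    P.τ (k + j) ((P.x ^ j) u) = P.τ k u := by
  induction j with
  | zero => rfl
  | succ j ih => rw [pow_succ', Module.End.mul_apply, ← add_assoc, P.τ_succ, ih]

lemma exists_τ_of_le (P : Polarization dU dG) (g : G) : ∃ k, ∀ j, k ≤ j → ∃ u, P.τ j u = g := by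
  obtain ⟨k, u, rfl⟩ := P.exists_τ g
  refine ⟨k, fun j hj => ⟨(P.x ^ (j - k)) u, ?_⟩⟩
  have := P.τ_add (j - k) k u
  rwa [Nat.add_sub_cancel' hj] at this

lemma x_pow_injective (P : Polarization dU dG) (k : ℕ) : Function.Injective ⇑(P.x ^ k) := by
  rw [Module.End.coe_pow]
  exact P.x_injective.iterate k

lemma d_x_pow (P : Polarization dU dG) (k : ℕ) (u : U) : dU ((P.x ^ k) u) = (P.x ^ k) (dU u) := by
  induction k with
  | zero => rfl
  | succ k ih => simp only [pow_succ', Module.End.mul_apply, P.d_x, ih]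

lemma killsHomology (P : Polarization dU dG) (hd : ∀ u, dU (dU u) = 0) {s : R}
    (hs : KillsHomology s dU) : KillsHomology (s * s) dG := by
  intro g hg
  obtain ⟨k, u, rfl⟩ := P.exists_τ g
  rw [← P.τ_d] at hg
  obtain ⟨u', hu'⟩ := P.exists_of_τ _ _ hg
  have h : dU u' = 0 := by
    apply P.x_pow_injective k
    rw [map_zero, ← P.d_x_pow, ← hu', hd]
  obtain ⟨w, hw⟩ := hs u' h
  obtain ⟨w', hw'⟩ := hs (s • u - (P.x ^ k) w) (by
    rw [map_sub, map_smul, hu', P.d_x_pow, ← hw, map_smul, sub_self])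
  refine ⟨P.τ k w', ?_⟩
  rw [← P.τ_d, ← hw', map_smul, map_sub, P.τ_pow, sub_zero, map_smul, smul_smul]

lemma exists_mapRange_τ (P : Polarization dU dG) (g : ℕ →₀ G) :
    ∃ k, ∀ j, k ≤ j → ∃ u : ℕ →₀ U, Finsupp.mapRange.linearMap (P.τ j) u = g := by
  induction g using Finsupp.induction_linear with
  | zero => exact ⟨0, fun j _ => ⟨0, map_zero _⟩⟩
  | add f g hf hg =>
    obtain ⟨k₁, h₁⟩ := hf
    obtain ⟨k₂, h₂⟩ := hg
    refine ⟨max k₁ k₂, fun j hj => ?_⟩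
    obtain ⟨u₁, hu₁⟩ := h₁ j (by omega)
    obtain ⟨u₂, hu₂⟩ := h₂ j (by omega)
    exact ⟨u₁ + u₂, by rw [map_add, hu₁, hu₂]⟩
  | single n g =>
    obtain ⟨k, hk⟩ := P.exists_τ_of_le g
    refine ⟨k, fun j hj => ?_⟩
    obtain ⟨u, rfl⟩ := hk j hj
    exact ⟨Finsupp.single n u, by simp⟩

lemma exists_of_mapRange_τ (P : Polarization dU dG) (k : ℕ) (u : ℕ →₀ U)
    (hu : Finsupp.mapRange.linearMap (P.τ k) u = 0) :
    ∃ u', u = Finsupp.mapRange.linearMap (P.x ^ k) u' := by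
  have h (n : ℕ) : ∃ u', u n = (P.x ^ k) u' := by
    apply P.exists_of_τ
    simpa using DFunLike.congr_fun hu n
  choose f hf using h
  refine ⟨Finsupp.onFinset u.support f fun n hn => ?_, ?_⟩
  · rw [Finsupp.mem_support_iff, hf]
    intro h0
    exact hn (P.x_pow_injective k (by rw [h0, map_zero]))
  · ext n
    simp [hf]

lemma mapRange_pow (f : U →ₗ[R] U) (k : ℕ) :
    (Finsupp.mapRange.linearMap f : (ℕ →₀ U) →ₗ[R] (ℕ →₀ U)) ^ k =
      Finsupp.mapRange.linearMap (f ^ k) := by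
  induction k with
  | zero => ext; simp
  | succ k ih =>
    ext
    simp [pow_succ', ih]

/-- Polarizations are preserved by the torsion step. -/
def torsionStep (P : Polarization dU dG) (b : R) :
    Polarization (torsionStep b dU) (torsionStep b dG) where
  x := (Finsupp.mapRange.linearMap P.x).prodMap (Finsupp.mapRange.linearMap P.x)
  τ k := (Finsupp.mapRange.linearMap (P.τ k)).prodMap (Finsupp.mapRange.linearMap (P.τ k))
  d_x u := by ext n <;> simp [P.d_x]
  τ_d k u := by ext n <;> simp [P.τ_d]
  x_injective := (Finsupp.mapRange_injective _ (map_zero _) P.x_injective).prodMap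
    (Finsupp.mapRange_injective _ (map_zero _) P.x_injective)
  τ_succ k u := by ext n <;> simp [P.τ_succ]
  exists_τ g := by
    obtain ⟨k₁, h₁⟩ := P.exists_mapRange_τ g.1
    obtain ⟨k₂, h₂⟩ := P.exists_mapRange_τ g.2
    obtain ⟨u₁, hu₁⟩ := h₁ (max k₁ k₂) (by omega)
    obtain ⟨u₂, hu₂⟩ := h₂ (max k₁ k₂) (by omega)
    exact ⟨max k₁ k₂, (u₁, u₂), Prod.ext hu₁ hu₂⟩
  τ_pow k u := by
    rw [prodMap_pow, mapRange_pow]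
    ext n <;> simp [P.τ_pow]
  exists_of_τ k u hu := by
    obtain ⟨u₁, h₁⟩ := P.exists_of_mapRange_τ k u.1 (congrArg Prod.fst hu)
    obtain ⟨u₂, h₂⟩ := P.exists_of_mapRange_τ k u.2 (congrArg Prod.snd hu)
    exact ⟨(u₁, u₂), by rw [prodMap_pow, mapRange_pow]; exact Prod.ext h₁ h₂⟩

end Polarization

end Polarization

section Torsion

variable {R : Type u} [CommRing R] {V : Type v} [AddCommGroup V] [Module R V]

lemma killsHomology_of_torsionStep (d : V →ₗ[R] V) (a s : R) (ha : ∀ v : V, ∃ n, a ^ n • v = 0)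
    (hs : KillsHomology s (torsionStep a d)) : KillsHomology s d := by
  intro v hv
  obtain ⟨m, hm⟩ := ha v
  let f : ℕ →₀ V := Finsupp.onFinset (Finset.range m) (fun n => a ^ n • v) (by
    intro n hn
    by_contra h
    simp only [Finset.mem_range, not_lt] at h
    apply hn
    rw [← Nat.sub_add_cancel h, pow_add, mul_smul, hm, smul_zero])
  have hf (n : ℕ) : f n = a ^ n • v := rfl
  obtain ⟨w, hw⟩ := hs (f, 0) (by
    ext n
    · simp [hf, hv]
    · simp [hf, pow_succ', mul_smul])
  refine ⟨w.1 0, ?_⟩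
  have := DFunLike.congr_fun (congrArg Prod.fst hw) 0
  simpa [hf] using this

lemma torsionStep_torsion (a : R) (hV : ∀ v : V, ∃ n, a ^ n • v = 0)
    (f : (ℕ →₀ V) × (ℕ →₀ V)) : ∃ n, a ^ n • f = 0 := by
  have mono {M : Type v} [AddCommGroup M] [Module R M] {m : M} {i j : ℕ} (hij : i ≤ j)
      (h : a ^ i • m = 0) : a ^ j • m = 0 := by
    rw [← Nat.sub_add_cancel hij, pow_add, mul_smul, h, smul_zero]
  have key (f : ℕ →₀ V) : ∃ n, a ^ n • f = 0 := by
    induction f using Finsupp.induction_linear with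
    | zero => exact ⟨0, smul_zero _⟩
    | add f g hf hg =>
      obtain ⟨n₁, h₁⟩ := hf
      obtain ⟨n₂, h₂⟩ := hg
      exact ⟨max n₁ n₂, by
        rw [smul_add, mono (le_max_left _ _) h₁, mono (le_max_right _ _) h₂, add_zero]⟩
    | single n v =>
      obtain ⟨m, hm⟩ := hV v
      exact ⟨m, by rw [Finsupp.smul_single, hm, Finsupp.single_zero]⟩
  obtain ⟨n₁, h₁⟩ := key f.1
  obtain ⟨n₂, h₂⟩ := key f.2
  exact ⟨max n₁ n₂, Prod.ext (mono (le_max_left _ _) h₁) (mono (le_max_right _ _) h₂)⟩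

end Torsion

section Descent

variable {R : Type u} [CommRing R]

/-- Every power series in `a` with coefficients in `R` converges. -/
def SeriesConverge (a : R) : Prop :=
  ∀ r : ℕ → R, ∃ ρ : ℕ → R, ∀ k, ρ k = r k + a * ρ (k + 1)

lemma exists_finite_generators {V : Type v} [AddCommGroup V] [Module R V] (d : V →ₗ[R] V)
    (Z : Submodule R V) (hZ : (Z.map (LinearMap.range d).mkQ).FG) :
    ∃ (n : ℕ) (e : Fin n → V), (∀ i, e i ∈ Z) ∧
      ∀ z ∈ Z, ∃ (r : Fin n → R) (w : V), z = ∑ i, r i • e i + d w := by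
  obtain ⟨n, g, hg⟩ := Submodule.fg_iff_exists_fin_generating_family.mp hZ
  have h (i : Fin n) : ∃ e ∈ Z, (LinearMap.range d).mkQ e = g i := by
    have : g i ∈ Z.map (LinearMap.range d).mkQ := hg ▸ Submodule.subset_span ⟨i, rfl⟩
    exact this
  choose e he heg using h
  refine ⟨n, e, he, fun z hz => ?_⟩
  have hz' : (LinearMap.range d).mkQ z ∈ Submodule.span R (Set.range g) :=
    hg ▸ Submodule.mem_map_of_mem hz
  obtain ⟨r, hr⟩ := (Submodule.mem_span_range_iff_exists_fun R).mp hz'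
  refine ⟨r, ?_⟩
  have : (LinearMap.range d).mkQ (z - ∑ i, r i • e i) = 0 := by
    simp only [map_sub, map_sum, map_smul, heg, hr, sub_self]
  rw [Submodule.mkQ_apply, Submodule.Quotient.mk_eq_zero] at this
  obtain ⟨w, hw⟩ := this
  exact ⟨w, by rw [hw]; abel⟩

lemma finiteHomology_of_generators {V : Type v} [AddCommGroup V] [Module R V] (d : V →ₗ[R] V)
    {n : ℕ} (e : Fin n → V) (he : ∀ i, d (e i) = 0)
    (h : ∀ z, d z = 0 → ∃ (r : Fin n → R) (w : V), z = ∑ i, r i • e i + d w) :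
    FiniteHomology d := by
  refine Submodule.fg_iff_exists_fin_generating_family.mpr
    ⟨n, fun i => (LinearMap.range d).mkQ (e i), le_antisymm ?_ ?_⟩
  · rw [Submodule.span_le]
    rintro _ ⟨i, rfl⟩
    exact Submodule.mem_map_of_mem (he i)
  · rintro _ ⟨z, hz, rfl⟩
    obtain ⟨r, w, rfl⟩ := h z hz
    refine (Submodule.mem_span_range_iff_exists_fun R).mpr ⟨r, ?_⟩
    have : (LinearMap.range d).mkQ (d w) = 0 := by
      rw [Submodule.mkQ_apply, Submodule.Quotient.mk_eq_zero]
      exact ⟨w, rfl⟩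
    rw [map_add, this, add_zero, map_sum]
    simp only [map_smul]

lemma exists_killsHomology {V : Type v} [AddCommGroup V] [Module R V] {d : V →ₗ[R] V}
    {p : Ideal R} [hp : p.IsPrime] (hfin : FiniteHomology d) (hvan : HomologyVanishesAt p d) :
    ∃ s ∉ p, KillsHomology s d := by
  obtain ⟨n, e, he, hgen⟩ := exists_finite_generators d _ hfin
  choose s hs w hw using fun i => hvan (e i) (he i)
  refine ⟨∏ i, s i, fun h => ?_, fun z hz => ?_⟩
  · obtain ⟨i, _, hi⟩ := hp.prod_mem_iff.mp h
    exact hs i hi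
  · obtain ⟨r, v, rfl⟩ := hgen z hz
    refine ⟨∑ i, (r i * ∏ j ∈ Finset.univ.erase i, s j) • w i + (∏ i, s i) • v, ?_⟩
    rw [smul_add, map_add, map_smul, map_sum, Finset.smul_sum]
    congr 1
    refine Finset.sum_congr rfl fun i hi => ?_
    rw [map_smul, ← hw, smul_smul, smul_smul, ← Finset.mul_prod_erase _ _ hi]
    congr 1
    ring

variable {W V : Type v} [AddCommGroup W] [Module R W] [AddCommGroup V] [Module R V]
  {dW : W →ₗ[R] W} {dV : V →ₗ[R] V} {a : R}

namespace Deformation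

lemma exists_generators_mod_x [IsNoetherianRing R] (D : Deformation a dW dV)
    (hW : ∀ w, dW (dW w) = 0) (hfin : FiniteHomology dV) :
    ∃ (n : ℕ) (e : Fin n → W), (∀ i, dW (e i) = 0) ∧
      ∀ z, dW z = 0 → ∃ (r : Fin n → R) (w z' : W), dW z' = 0 ∧
        z = ∑ i, r i • e i + dW w + D.x z' := by
  let Z : Submodule R V := (LinearMap.ker dW).map D.π
  have hZ : (Z.map (LinearMap.range dV).mkQ).FG := by
    have := isNoetherian_of_fg_of_noetherian _ hfin
    refine Submodule.FG.of_le_of_isNoetherian (Submodule.map_mono ?_)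
      (T := (LinearMap.ker dV).map (LinearMap.range dV).mkQ)
    rintro _ ⟨w, hw, rfl⟩
    rw [SetLike.mem_coe, LinearMap.mem_ker] at hw
    rw [LinearMap.mem_ker, ← D.π_d, hw, map_zero]
  obtain ⟨n, e, he, hgen⟩ := exists_finite_generators dV Z hZ
  choose f hf hfe using he
  refine ⟨n, f, hf, fun z hz => ?_⟩
  obtain ⟨r, v, hv⟩ := hgen (D.π z) (Submodule.mem_map_of_mem hz)
  obtain ⟨w, rfl⟩ := D.π_surjective v
  obtain ⟨z', hz'⟩ := D.exists_of_π (z - (∑ i, r i • f i + dW w)) (by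
    rw [map_sub, hv, map_add, map_sum, D.π_d]
    simp only [map_smul, hfe, sub_self])
  refine ⟨r, w, z', ?_, by rw [← hz']; abel⟩
  apply D.x_injective
  rw [map_zero, ← D.d_x, ← hz', map_sub, map_add, hz, hW, map_sum]
  simp only [map_smul, LinearMap.mem_ker.mp (hf _), smul_zero, Finset.sum_const_zero, add_zero,
    sub_zero]

lemma finiteHomology [IsNoetherianRing R] (D : Deformation a dW dV) (hW : ∀ w, dW (dW w) = 0)
    (ha : SeriesConverge a) (hfin : FiniteHomology dV) : FiniteHomology dW := by
  obtain ⟨n, e, he, hgen⟩ := D.exists_generators_mod_x hW hfin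
  refine finiteHomology_of_generators dW e he fun z hz => ?_
  choose r w z' hz' hzr using fun z : LinearMap.ker dW => hgen z z.2
  obtain ⟨Z, hZ₀, hZs⟩ : ∃ Z : ℕ → LinearMap.ker dW,
      (Z 0 : W) = z ∧ ∀ k, (Z (k + 1) : W) = z' (Z k) :=
    ⟨fun k => Nat.rec ⟨z, hz⟩ (fun _ y => ⟨z' y, hz' y⟩) k, rfl, fun _ => rfl⟩
  have hZ (k : ℕ) : (Z k : W) = ∑ i, r (Z k) i • e i + dW (w (Z k)) + D.x (Z (k + 1)) := by
    rw [hZs]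
    exact hzr (Z k)
  choose ρ hρ using fun i => ha (fun k => r (Z k) i)
  let y : ℕ → W := fun k => Z k - ∑ i, ρ i k • e i
  have hde (k : ℕ) : dW (∑ i, ρ i k • e i) = 0 := by
    simp only [map_sum, map_smul, he, smul_zero, Finset.sum_const_zero]
  have hy (k : ℕ) : y k = dW (w (Z k) + D.h (∑ i, ρ i (k + 1) • e i)) + D.x (y (k + 1)) := by
    have h₁ : D.x (∑ i, ρ i (k + 1) • e i) =
        a • (∑ i, ρ i (k + 1) • e i) + dW (D.h (∑ i, ρ i (k + 1) • e i)) := by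
      rw [D.homotopy, hde, map_zero, add_zero]
    have h₂ : ∑ i, ρ i k • e i = ∑ i, r (Z k) i • e i + a • (∑ i, ρ i (k + 1) • e i) := by
      rw [Finset.smul_sum, ← Finset.sum_add_distrib]
      refine Finset.sum_congr rfl fun i _ => ?_
      rw [hρ i k, add_smul, mul_smul]
    simp only [y]
    rw [map_sub, h₁, map_add, h₂]
    nth_rewrite 1 [hZ k]
    abel
  obtain ⟨ω, hω⟩ := D.complete fun k => w (Z k) + D.h (∑ i, ρ i (k + 1) • e i)
  have h0 := D.separated (fun k => y k - dW (ω k)) (fun k => by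
    rw [map_sub, hy k, hω k, map_add dW (_ + _) (D.x _), D.d_x]
    abel) 0
  refine ⟨fun i => ρ i 0, ω 0, ?_⟩
  have h1 : (Z 0 : W) - ∑ i, ρ i 0 • e i - dW (ω 0) = 0 := h0
  rw [hZ₀, sub_sub, sub_eq_zero] at h1
  exact h1

lemma homologyVanishesAt (D : Deformation a dW dV) {p : Ideal R} [hp : p.IsPrime] (ha : a ∈ p)
    (hW : ∀ w, dW (dW w) = 0) (hfin : FiniteHomology dW) (hvan : HomologyVanishesAt p dV) :
    HomologyVanishesAt p dW := by
  obtain ⟨n, e, he, hgen⟩ := exists_finite_generators dW _ hfin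
  have key (z : W) (hz : dW z = 0) : ∃ s ∉ p, ∃ (c : Fin n → R) (w : W),
      s • z = a • (∑ i, c i • e i) + dW w := by
    obtain ⟨s, hs, v, hv⟩ := hvan (D.π z) (by rw [← D.π_d, hz, map_zero])
    obtain ⟨w, rfl⟩ := D.π_surjective v
    obtain ⟨z', hz'⟩ := D.exists_of_π (s • z - dW w) (by
      rw [map_sub, map_smul, hv, D.π_d, sub_self])
    have hdz' : dW z' = 0 := by
      apply D.x_injective
      rw [map_zero, ← D.d_x, ← hz', map_sub, map_smul, hz, hW, smul_zero, sub_zero]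
    obtain ⟨c, w', hc⟩ := hgen z' hdz'
    refine ⟨s, hs, c, w + a • w' + D.h z', ?_⟩
    rw [← sub_add_cancel (s • z) (dW w), hz', D.homotopy, hdz', map_zero, add_zero]
    nth_rewrite 1 [hc]
    simp only [map_add, map_smul, smul_add]
    abel
  choose s hs c w hw using fun i => key (e i) (he i)
  let A : Matrix (Fin n) (Fin n) R := Matrix.diagonal s - a • Matrix.of c
  have hA (i : Fin n) : ∑ j, A i j • e j = dW (w i) := by
    have : ∑ j, A i j • e j = s i • e i - a • ∑ j, c i j • e j := by
      simp only [A, Matrix.sub_apply, Matrix.smul_apply, Matrix.of_apply, sub_smul,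
        Finset.sum_sub_distrib, Matrix.diagonal_apply, ite_smul, zero_smul,
        Finset.sum_ite_eq, Finset.mem_univ, if_true, smul_eq_mul, mul_smul, Finset.smul_sum]
    rw [this, hw i]
    abel
  have hdet : A.det ∉ p := by
    intro h
    have h1 : Ideal.Quotient.mk p A.det = 0 := Ideal.Quotient.eq_zero_iff_mem.mpr h
    have h2 : (Ideal.Quotient.mk p).mapMatrix A =
        Matrix.diagonal (fun i => Ideal.Quotient.mk p (s i)) := by
      ext i j
      have : Ideal.Quotient.mk p a = 0 := Ideal.Quotient.eq_zero_iff_mem.mpr ha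
      by_cases hij : i = j <;> simp [A, this, hij]
    rw [RingHom.map_det, h2, Matrix.det_diagonal, ← map_prod, Ideal.Quotient.eq_zero_iff_mem,
      hp.prod_mem_iff] at h1
    obtain ⟨i, _, hi⟩ := h1
    exact hs i hi
  have hdete (i : Fin n) : A.det • e i = dW (∑ j, A.adjugate i j • w j) := by
    have h1 : ∑ j, (A.adjugate * A) i j • e j = A.det • e i := by
      rw [Matrix.adjugate_mul]
      simp [Matrix.one_apply]
    rw [← h1, map_sum]
    simp only [map_smul, ← hA, Matrix.mul_apply, Finset.sum_smul, Finset.smul_sum, smul_smul]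
    exact Finset.sum_comm
  intro z hz
  obtain ⟨r, v, rfl⟩ := hgen z hz
  refine ⟨A.det, hdet, ∑ i, r i • (∑ j, A.adjugate i j • w j) + A.det • v, ?_⟩
  rw [smul_add, map_add, map_smul, map_sum, Finset.smul_sum]
  congr 1
  refine Finset.sum_congr rfl fun i _ => ?_
  rw [map_smul, ← hdete, smul_comm]

end Deformation

end Descent

/-- A module with a square-zero endomorphism. -/
structure Obj (R : Type u) [CommRing R] where
  /-- the underlying module -/
  carrier : Type v
  [addCommGroup : AddCommGroup carrier]
  [module : Module R carrier]
  /-- the differential -/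
  d : carrier →ₗ[R] carrier
  d_d : ∀ v, d (d v) = 0

attribute [instance] Obj.addCommGroup Obj.module

section Iterated

variable {R : Type u} [CommRing R]

/-- The iterated Koszul construction. -/
def koszul : List R → Obj.{u, v} R → Obj.{u, v} R
  | [], V => V
  | a :: l, V => koszul l ⟨_, koszulStep a V.d, koszulStep_koszulStep a V.d V.d_d⟩

/-- The iterated derived torsion construction. -/
def torsion : List R → Obj.{u, v} R → Obj.{u, v} R
  | [], V => V
  | a :: l, V => torsion l ⟨_, torsionStep a V.d, torsionStep_torsionStep a V.d V.d_d⟩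

/-- Deformations are preserved by the iterated Koszul construction. -/
def Deformation.koszul {a : R} : ∀ (l : List R) {W V : Obj.{u, v} R},
    Deformation a W.d V.d → Deformation a (koszul l W).d (koszul l V).d
  | [], _, _, D => D
  | b :: l, _, _, D => Deformation.koszul l (D.koszulStep b)

/-- Polarizations are preserved by the iterated torsion construction. -/
def Polarization.torsion : ∀ (l : List R) {U G : Obj.{u, v} R},
    Polarization U.d G.d → Polarization (torsion l U).d (torsion l G).d
  | [], _, _, P => P
  | b :: l, _, _, P => Polarization.torsion l (P.torsionStep b)

theorem exists_killsHomology_torsion [IsNoetherianRing R] {p : Ideal R} [hp : p.IsPrime]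
    (l : List R) (hl : ∀ a ∈ l, a ∈ p ∧ SeriesConverge a) (V : Obj.{u, v} R)
    (hfin : FiniteHomology (koszul l V).d) (hvan : HomologyVanishesAt p (koszul l V).d) :
    ∃ s ∉ p, KillsHomology s (torsion l V).d := by
  induction l generalizing V with
  | nil => exact exists_killsHomology hfin hvan
  | cons a l ih =>
    obtain ⟨ha, hconv⟩ := hl a List.mem_cons_self
    let W : Obj.{u, v} R := ⟨_, completionStep a V.d, completionStep_completionStep a V.d V.d_d⟩
    have D : Deformation a (koszul l W).d (koszul (a :: l) V).d :=
      Deformation.koszul l (W := W) (deformationStep a V.d)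
    have hW := D.finiteHomology (koszul l W).d_d hconv hfin
    obtain ⟨s, hs, hkill⟩ := ih (fun b hb => hl b (List.mem_cons_of_mem _ hb)) W hW
      (D.homologyVanishesAt ha (koszul l W).d_d hW hvan)
    have P : Polarization (torsion l W).d (torsion (a :: l) V).d :=
      Polarization.torsion l (U := W) (polarizationStep a V.d)
    exact ⟨s * s, fun h => (hp.mem_or_mem h).elim hs hs,
      P.killsHomology (torsion l W).d_d hkill⟩

lemma killsHomology_of_torsion (l : List R) (V : Obj.{u, v} R) (s : R)
    (hl : ∀ a ∈ l, ∀ v : V.carrier, ∃ n, a ^ n • v = 0)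
    (hs : KillsHomology s (torsion l V).d) : KillsHomology s V.d := by
  induction l generalizing V with
  | nil => exact hs
  | cons a l ih =>
    refine killsHomology_of_torsionStep V.d a s (hl a List.mem_cons_self) (ih _ ?_ hs)
    intro b hb
    exact torsionStep_torsion b (hl b (List.mem_cons_of_mem _ hb))

end Iterated

lemma seriesConverge_of_mem {R : Type u} [CommRing R] (J : Ideal R) [IsAdicComplete J R] {a : R}
    (ha : a ∈ J) : SeriesConverge a := by
  intro r
  let F : ℕ → ℕ → R := fun k m => ∑ j ∈ Finset.range m, a ^ j * r (k + j)
  have hF (k : ℕ) {m n : ℕ} (hmn : m ≤ n) : F k m ≡ F k n [SMOD (J ^ m • ⊤ : Submodule R R)] := by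
    rw [SModEq.comm, SModEq.sub_mem]
    simp only [F]
    rw [← Finset.sum_range_add_sum_Ico _ hmn, add_sub_cancel_left, smul_eq_mul,
      Ideal.mul_top]
    refine Ideal.sum_mem _ fun j hj => Ideal.mul_mem_right _ _ ?_
    exact Ideal.pow_le_pow_right (Finset.mem_Ico.mp hj).1 (Ideal.pow_mem_pow ha j)
  choose ρ hρ using fun k => IsPrecomplete.prec (inferInstance : IsPrecomplete J R) (hF k)
  refine ⟨ρ, fun k => ?_⟩
  rw [IsHausdorff.eq_iff_smodEq (I := J)]
  intro n
  have h1 : F k (n + 1) = r k + a * F (k + 1) n := by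
    simp only [F, Finset.sum_range_succ', Finset.mul_sum]
    rw [add_comm]
    congr 1
    · simp
    · refine Finset.sum_congr rfl fun j _ => ?_
      rw [show k + (j + 1) = k + 1 + j by ring]
      ring
  have h2 := (hF k n.le_succ).symm.trans (hρ k n)
  rw [Nat.succ_eq_add_one, h1] at h2
  exact h2.symm.trans ((SModEq.refl (r k)).add ((hρ (k + 1) n).smul a))

section Koszul

variable {R : Type u} [CommRing R]

lemma koszul_killed (l : List R) {p : Ideal R} [hp : p.IsPrime] (V : Obj.{u, v} R)
    (hV : ∀ v : V.carrier, ∃ s ∉ p, s • v = 0) (v : (koszul l V).carrier) :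
    ∃ s ∉ p, s • v = 0 := by
  induction l generalizing V with
  | nil => exact hV v
  | cons a l ih =>
    refine ih _ (fun v => ?_) v
    obtain ⟨s, hs, hsv⟩ := hV v.1
    obtain ⟨t, ht, htv⟩ := hV v.2
    refine ⟨s * t, fun h => (hp.mem_or_mem h).elim hs ht, Prod.ext ?_ ?_⟩
    · change (s * t) • v.1 = 0
      rw [mul_comm, mul_smul, hsv, smul_zero]
    · change (s * t) • v.2 = 0
      rw [mul_smul, htv, smul_zero]

/-- A module with the zero differential. -/
def Obj.ofModule (R : Type u) [CommRing R] (M : Type v) [AddCommGroup M] [Module R M] :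
    Obj.{u, v} R where
  carrier := M
  d := 0
  d_d _ := rfl

theorem support_eq_zeroLocus_of_finiteHomology [IsNoetherianRing R] (J : Ideal R)
    [IsAdicComplete J R] (l : List R) {M : Type v} [AddCommGroup M] [Module R M]
    (hl : ∀ a ∈ l, a ∈ J)
    (hsupp : Module.support R M ⊆ PrimeSpectrum.zeroLocus {a | a ∈ l})
    (hfin : FiniteHomology (koszul l (Obj.ofModule R M)).d) :
    Module.support R M =
      PrimeSpectrum.zeroLocus ({a | a ∈ l} ∪ (Module.annihilator R M : Set R)) := by
  apply subset_antisymm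
  · rw [PrimeSpectrum.zeroLocus_union]
    exact Set.subset_inter hsupp fun p hp => Module.annihilator_le_of_mem_support hp
  · intro p hp
    rw [PrimeSpectrum.zeroLocus_union] at hp
    by_contra hps
    rw [Module.notMem_support_iff'] at hps
    obtain ⟨s, hs, hkill⟩ := exists_killsHomology_torsion (p := p.asIdeal) l
      (fun a ha => ⟨hp.1 ha, seriesConverge_of_mem J (hl a ha)⟩) (Obj.ofModule R M) hfin (by
        intro v _
        obtain ⟨s, hs, hsv⟩ := koszul_killed l (p := p.asIdeal) (Obj.ofModule R M) hps v
        exact ⟨s, hs, 0, by rw [hsv, map_zero]⟩)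
    have := killsHomology_of_torsion l (Obj.ofModule R M) s (by
      intro a ha (v : M)
      by_contra! h
      obtain ⟨q, hq, hle, hdis⟩ := Ideal.exists_le_prime_disjoint (R ∙ v).annihilator
        (Submonoid.powers a) (by
          rw [Set.disjoint_left]
          rintro _ hb ⟨n, rfl⟩
          exact h n (by
            rwa [SetLike.mem_coe, Submodule.mem_annihilator_span_singleton] at hb))
      have hmem : (⟨q, hq⟩ : PrimeSpectrum R) ∈ Module.support R M :=
        Module.mem_support_iff_exists_annihilator.mpr ⟨v, hle⟩
      exact Set.disjoint_left.mp hdis (hsupp hmem ha) (Submonoid.mem_powers a)) hkill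
    refine hs (hp.2 ?_)
    rw [SetLike.mem_coe, Module.mem_annihilator]
    intro m
    obtain ⟨w, hw⟩ := this m rfl
    exact hw

end Koszul


section ExtFinite

variable {R : Type u} [CommRing R]

lemma finite_abelianExt (N Y : ModuleCat.{u} R) (n : ℕ)
    (h : Module.Finite R (((Ext R (ModuleCat.{u} R) n).obj (Opposite.op N)).obj Y)) :
    Module.Finite R (Abelian.Ext N Y n) := by
  let P : ProjectiveResolution N := projectiveResolution N
  let K := P.complex.linearYonedaObj R Y
  have hK : Module.Finite R (K.homology n) := Module.Finite.equiv (P.isoExt n Y).toLinearEquiv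
  let c : K.cycles n →ₗ[R] (P.complex.X n ⟶ Y) := (K.iCycles n).hom
  have hd (x : K.cycles n) : P.complex.d (n + 1) n ≫ c x = 0 :=
    LinearMap.congr_fun (congrArg ModuleCat.Hom.hom (K.iCycles_d n (n + 1))) x
  let φ : K.cycles n →ₗ[R] Abelian.Ext N Y n :=
    { toFun x := P.extMk (c x) (n + 1) rfl (hd x)
      map_add' x y := by
        rw [P.add_extMk]
        simp only [map_add]
      map_smul' r x := by
        rw [Abelian.Ext.smul_eq_comp_mk₀, RingHom.id_apply, P.extMk_comp_mk₀]
        simp only [Linear.comp_smul, Category.comp_id, map_smul] }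
  have hφ : Function.Surjective φ := by
    intro α
    obtain ⟨f, hf, rfl⟩ := P.extMk_surjective α (n + 1) rfl
    have hex : (ShortComplex.mk _ _ (K.iCycles_d n (n + 1))).Exact :=
      ShortComplex.exact_of_f_is_kernel _ (K.cyclesIsKernel n (n + 1) (by simp))
    obtain ⟨x, hx⟩ := (ShortComplex.moduleCat_exact_iff _).mp hex f hf
    refine ⟨x, ?_⟩
    change P.extMk (c x) (n + 1) rfl (hd x) = _
    congr 1
  have hker : LinearMap.ker (K.homologyπ n).hom ≤ LinearMap.ker φ := by
    intro x hx
    have hex := ShortComplex.exact_of_g_is_cokernel (ShortComplex.mk _ _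
      (K.toCycles_comp_homologyπ _ n)) (K.homologyIsCokernel _ n rfl)
    obtain ⟨y, hy⟩ := (ShortComplex.moduleCat_exact_iff _).mp hex x hx
    have hxy : K.iCycles n x = K.d ((ComplexShape.up ℕ).prev n) n y := by
      rw [← hy, ← K.toCycles_i]
      rfl
    change P.extMk (c x) (n + 1) rfl (hd x) = 0
    by_cases hp : (ComplexShape.up ℕ).prev n + 1 = n
    · rw [P.extMk_eq_zero_iff _ _ _ _ _ hp]
      exact ⟨y, hxy.symm⟩
    · rw [K.shape _ _ hp] at hxy
      have h0 : c x = 0 := hxy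
      simp only [h0, P.extMk_zero]
  have hπ : Function.Surjective (K.homologyπ n).hom :=
    (ModuleCat.epi_iff_surjective _).mp inferInstance
  have := Module.Finite.equiv (LinearMap.quotKerEquivOfSurjective _ hπ).symm
  exact Module.Finite.of_surjective ((LinearMap.ker (K.homologyπ n).hom).liftQ φ hker)
    (by
      intro α
      obtain ⟨x, hx⟩ := hφ α
      exact ⟨Submodule.Quotient.mk x, hx⟩)

/-- The modules `Ext^i(N, X)` are all finitely generated. -/
def ExtFinite (N : ModuleCat.{u} R) (X : Type u) [AddCommGroup X] [Module R X] : Prop :=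
  ∀ i, Module.Finite R (Abelian.Ext N (ModuleCat.of R X) i)

namespace ExtFinite

variable {N : ModuleCat.{u} R} {X Y Z : Type u} [AddCommGroup X] [Module R X] [AddCommGroup Y]
  [Module R Y] [AddCommGroup Z] [Module R Z]

lemma of_exact_middle [IsNoetherianRing R] {A B C : Type*} [AddCommGroup A] [Module R A]
    [AddCommGroup B] [Module R B] [AddCommGroup C] [Module R C] (f : A →ₗ[R] B) (g : B →ₗ[R] C)
    (hfg : ∀ b, g b = 0 → ∃ a, f a = b) [Module.Finite R A] [Module.Finite R C] :
    Module.Finite R B := by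
  refine ⟨Submodule.fg_of_fg_map_of_fg_inf_ker g (IsNoetherian.noetherian _) ?_⟩
  refine Submodule.FG.of_le_of_isNoetherian (T := LinearMap.range f) fun b hb => ?_
  exact hfg b hb.2

lemma shortExact (f : X →ₗ[R] Y) (g : Y →ₗ[R] Z) (hf : Function.Injective f)
    (hg : Function.Surjective g) (hfg : ∀ y, g y = 0 ↔ ∃ x, f x = y) :
    (ShortComplex.mk (ModuleCat.ofHom f) (ModuleCat.ofHom g)
      (by ext x; exact (hfg _).mpr ⟨x, rfl⟩)).ShortExact where
  exact := (ShortComplex.moduleCat_exact_iff _).mpr fun y hy => (hfg y).mp hy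
  mono_f := (ModuleCat.mono_iff_injective _).mpr hf
  epi_g := (ModuleCat.epi_iff_surjective _).mpr hg

lemma middle [IsNoetherianRing R] (f : X →ₗ[R] Y) (g : Y →ₗ[R] Z) (hf : Function.Injective f)
    (hg : Function.Surjective g) (hfg : ∀ y, g y = 0 ↔ ∃ x, f x = y)
    (hX : ExtFinite N X) (hZ : ExtFinite N Z) : ExtFinite N Y := by
  intro i
  have hS := shortExact f g hf hg hfg
  have := hX i
  have := hZ i
  exact of_exact_middle
    ((Abelian.Ext.mk₀ (ModuleCat.ofHom f)).postcompOfLinear R N (add_zero i))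
    ((Abelian.Ext.mk₀ (ModuleCat.ofHom g)).postcompOfLinear R N (add_zero i))
    (fun b hb => Abelian.Ext.covariant_sequence_exact₂ N hS b hb)

lemma right [IsNoetherianRing R] (f : X →ₗ[R] Y) (g : Y →ₗ[R] Z) (hf : Function.Injective f)
    (hg : Function.Surjective g) (hfg : ∀ y, g y = 0 ↔ ∃ x, f x = y)
    (hX : ExtFinite N X) (hY : ExtFinite N Y) : ExtFinite N Z := by
  intro i
  have hS := shortExact f g hf hg hfg
  have := hY i
  have := hX (i + 1)
  exact of_exact_middle
    ((Abelian.Ext.mk₀ (ModuleCat.ofHom g)).postcompOfLinear R N (add_zero i))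
    (hS.extClass.postcompOfLinear R N rfl)
    (fun b hb => Abelian.Ext.covariant_sequence_exact₃ N hS b rfl hb)

lemma of_retract (f : X →ₗ[R] Y) (g : Y →ₗ[R] X) (hgf : ∀ x, g (f x) = x)
    (hY : ExtFinite N Y) : ExtFinite N X := by
  intro i
  have := hY i
  refine Module.Finite.of_surjective
    ((Abelian.Ext.mk₀ (ModuleCat.ofHom g)).postcompOfLinear R N (add_zero i)) fun x =>
    ⟨(Abelian.Ext.mk₀ (ModuleCat.ofHom f)).postcompOfLinear R N (add_zero i) x, ?_⟩
  have h : ModuleCat.ofHom f ≫ ModuleCat.ofHom g = 𝟙 (ModuleCat.of R X) := by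
    ext x
    exact hgf x
  simp [h]

lemma of_finite [IsNoetherianRing R] [Module.Finite R N] [Module.Finite R X] : ExtFinite N X :=
  fun i => ModuleCat.finite_ext R N (ModuleCat.of R X) i

lemma prod [IsNoetherianRing R] (hX : ExtFinite N X) (hY : ExtFinite N Y) :
    ExtFinite N (X × Y) :=
  middle (LinearMap.inl R X Y) (LinearMap.snd R X Y) LinearMap.inl_injective
    LinearMap.snd_surjective (fun y => ⟨fun h => ⟨y.1, Prod.ext rfl h.symm⟩, by
      rintro ⟨x, rfl⟩; rfl⟩) hX hY

lemma fg_of_smul_eq_zero [IsNoetherianRing R] {I : Ideal R}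
    (hX : ExtFinite (ModuleCat.of R (R ⧸ I)) X) (S : Submodule R X)
    (hS : ∀ a ∈ I, ∀ x ∈ S, a • x = 0) : S.FG := by
  have h0 := hX 0
  have h1 : Module.Finite R (ModuleCat.of R (R ⧸ I) →ₗ[R] ModuleCat.of R X) :=
    Module.Finite.equiv
      ((Abelian.Ext.linearEquiv₀ (R := R)).trans ModuleCat.homLinearEquiv)
  let ev : ((R ⧸ I) →ₗ[R] X) →ₗ[R] X := LinearMap.applyₗ (1 : R ⧸ I)
  refine Submodule.FG.of_le_of_isNoetherian (T := LinearMap.range ev) fun x hx => ?_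
  refine ⟨I.liftQ (LinearMap.toSpanSingleton R X x) fun a ha => hS a ha x hx, ?_⟩
  exact (one_smul R x)

end ExtFinite

end ExtFinite

section Homotopy

variable {R : Type u} [CommRing R] {V : Type v} [AddCommGroup V] [Module R V]

/-- Multiplication by `a` is null-homotopic. -/
def NullHomotopic (a : R) (d : V →ₗ[R] V) : Prop :=
  ∃ h : V →ₗ[R] V, ∀ v, a • v = d (h v) + h (d v)

lemma nullHomotopic_koszulStep (a : R) (d : V →ₗ[R] V) : NullHomotopic a (koszulStep a d) :=
  ⟨LinearMap.inl R V V ∘ₗ LinearMap.snd R V V, fun v => by ext <;> simp⟩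

lemma NullHomotopic.koszulStep {a : R} {d : V →ₗ[R] V} (ha : NullHomotopic a d) (b : R) :
    NullHomotopic a (koszulStep b d) := by
  obtain ⟨h, hh⟩ := ha
  refine ⟨h.prodMap (-h), fun v => Prod.ext ?_ ?_⟩
  · simpa using hh v.1
  · have := hh v.2
    simp only [Prod.smul_snd, this]
    simp
    abel

lemma NullHomotopic.koszul {a : R} (l : List R) {V : Obj.{u, v} R} (ha : NullHomotopic a V.d) :
    NullHomotopic a (koszul l V).d := by
  induction l generalizing V with
  | nil => exact ha
  | cons b l ih => exact ih (ha.koszulStep b)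

lemma nullHomotopic_koszul {a : R} {l : List R} (ha : a ∈ l) (V : Obj.{u, v} R) :
    NullHomotopic a (koszul l V).d := by
  induction l generalizing V with
  | nil => simp at ha
  | cons b l ih =>
    rcases List.mem_cons.mp ha with rfl | ha
    · exact NullHomotopic.koszul l (nullHomotopic_koszulStep a V.d)
    · exact ih ha _

lemma killsHomology_koszul (l : List R) (V : Obj.{u, v} R) {a : R}
    (ha : a ∈ Ideal.span {b | b ∈ l}) : KillsHomology a (koszul l V).d := by
  induction ha using Submodule.span_induction with
  | mem b hb =>
    obtain ⟨h, hh⟩ := nullHomotopic_koszul hb V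
    exact fun z hz => ⟨h z, by rw [hh, hz, map_zero, add_zero]⟩
  | zero => exact fun z _ => ⟨0, by rw [zero_smul, map_zero]⟩
  | add b c _ _ hb hc =>
    intro z hz
    obtain ⟨x, hx⟩ := hb z hz
    obtain ⟨y, hy⟩ := hc z hz
    exact ⟨x + y, by rw [add_smul, map_add, hx, hy]⟩
  | smul r b _ hb =>
    intro z hz
    obtain ⟨x, hx⟩ := hb z hz
    exact ⟨r • x, by rw [smul_eq_mul, mul_smul, map_smul, hx]⟩

end Homotopy

section Grading

variable {R : Type u} [CommRing R] {V : Type v} [AddCommGroup V] [Module R V]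

/-- The projections of a bounded grading for which `d` has degree one. -/
structure Grading (d : V →ₗ[R] V) where
  /-- the projection to the part of degree `j` -/
  proj : ℕ → V →ₗ[R] V
  proj_proj : ∀ j v, proj j (proj j v) = proj j v
  proj_zero_d : ∀ v, proj 0 (d v) = 0
  proj_succ_d : ∀ j v, proj (j + 1) (d v) = d (proj j v)
  exists_sum : ∃ n, ∀ m, n ≤ m → ∀ v, ∑ j ∈ Finset.range m, proj j v = v

/-- A module concentrated in degree zero. -/
def Grading.ofModule (R : Type u) [CommRing R] (M : Type v) [AddCommGroup M] [Module R M] :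
    Grading (Obj.ofModule R M).d where
  proj
    | 0 => LinearMap.id
    | _ + 1 => 0
  proj_proj j _ := by cases j <;> rfl
  proj_zero_d _ := rfl
  proj_succ_d j _ := by cases j <;> rfl
  exists_sum := by
    refine ⟨1, fun m hm v => ?_⟩
    obtain ⟨m, rfl⟩ := Nat.exists_eq_add_of_le' hm
    rw [Finset.sum_range_succ']
    simp

/-- Gradings are preserved by the Koszul step. -/
def Grading.koszulStep {d : V →ₗ[R] V} (G : Grading d) (a : R) : Grading (koszulStep a d) where
  proj
    | 0 => (G.proj 0).prodMap 0
    | j + 1 => (G.proj (j + 1)).prodMap (G.proj j)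
  proj_proj j v := by cases j <;> simp [G.proj_proj]
  proj_zero_d v := by simp [G.proj_zero_d]
  proj_succ_d j v := by cases j <;> simp [G.proj_succ_d, G.proj_zero_d]
  exists_sum := by
    obtain ⟨n, hn⟩ := G.exists_sum
    refine ⟨n + 1, fun m hm v => ?_⟩
    obtain ⟨m, rfl⟩ := Nat.exists_eq_add_of_le' (le_add_self.trans hm)
    have h1 := hn (m + 1) (by omega) v.1
    rw [Finset.sum_range_succ'] at h1
    rw [Finset.sum_range_succ']
    ext
    · simpa [Prod.fst_sum] using h1
    · simpa [Prod.snd_sum] using hn m (by omega) v.2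

/-- Gradings are preserved by the iterated Koszul construction. -/
def Grading.koszul : ∀ (l : List R) {V : Obj.{u, v} R}, Grading V.d → Grading (koszul l V).d
  | [], _, G => G
  | a :: l, _, G => Grading.koszul l (G.koszulStep a)

end Grading

section ExtFinite

variable {R : Type u} [CommRing R] [IsNoetherianRing R]

lemma ExtFinite.koszul {N : ModuleCat.{u} R} (l : List R) (V : Obj.{u, u} R)
    (hV : ExtFinite N V.carrier) : ExtFinite N (koszul l V).carrier := by
  induction l generalizing V with
  | nil => exact hV
  | cons a l ih => exact ih _ (hV.prod hV)

lemma finiteHomology_of_extFinite {I : Ideal R} {V : Type u} [AddCommGroup V] [Module R V]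
    {d : V →ₗ[R] V} (hd : ∀ v, d (d v) = 0) (G : Grading d) (hI : ∀ a ∈ I, KillsHomology a d)
    (hV : ExtFinite (ModuleCat.of R (R ⧸ I)) V) : FiniteHomology d := by
  let Z : ℕ → Submodule R V := fun j => LinearMap.range (G.proj j) ⊓ LinearMap.ker d
  let B : ℕ → Submodule R V := fun
    | 0 => ⊥
    | j + 1 => (LinearMap.range (G.proj j)).map d
  have hproj {j : ℕ} {z : V} (hz : z ∈ LinearMap.range (G.proj j)) : G.proj j z = z := by
    obtain ⟨v, rfl⟩ := hz
    exact G.proj_proj j v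
  have hBd (j : ℕ) : B j ≤ LinearMap.range d := by
    cases j with
    | zero => exact bot_le
    | succ j => exact LinearMap.map_le_range
  have hBZ (j : ℕ) : B j ≤ Z j := by
    cases j with
    | zero => exact bot_le
    | succ j =>
      rintro _ ⟨_, ⟨v, rfl⟩, rfl⟩
      exact ⟨⟨d v, G.proj_succ_d j v⟩, hd _⟩
  have hIZ (j : ℕ) (a : R) (ha : a ∈ I) (z : V) (hz : z ∈ Z j) : a • z ∈ B j := by
    obtain ⟨w, hw⟩ := hI a ha z hz.2
    rw [← hproj hz.1, ← map_smul, hw]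
    cases j with
    | zero => exact G.proj_zero_d w
    | succ j => exact ⟨_, ⟨w, rfl⟩, (G.proj_succ_d j w).symm⟩
  have hS (j : ℕ) (hB : ExtFinite (ModuleCat.of R (R ⧸ I)) (↥(B j))) :
      (Submodule.map (B j).mkQ (Z j)).FG := by
    have hQ : ExtFinite (ModuleCat.of R (R ⧸ I)) (V ⧸ B j) :=
      ExtFinite.right (B j).subtype (B j).mkQ (B j).injective_subtype (B j).mkQ_surjective
        (fun y => by simp) hB hV
    refine hQ.fg_of_smul_eq_zero _ ?_
    rintro a ha _ ⟨z, hz, rfl⟩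
    rw [← map_smul, Submodule.mkQ_apply, Submodule.Quotient.mk_eq_zero]
    exact hIZ j a ha z hz
  have hB (j : ℕ) : ExtFinite (ModuleCat.of R (R ⧸ I)) (↥(B j)) := by
    induction j with
    | zero =>
      have : Module.Finite R (↥(B 0)) := inferInstanceAs (Module.Finite R (⊥ : Submodule R V))
      exact ExtFinite.of_finite
    | succ j ih =>
      have hfin : Module.Finite R (↥(Submodule.map (B j).mkQ (Z j))) := Module.Finite.iff_fg.mpr (hS j ih)
      have hZ : ExtFinite (ModuleCat.of R (R ⧸ I)) (↥(Z j)) :=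
        ExtFinite.middle (Submodule.inclusion (hBZ j))
          ((B j).mkQ.restrict (p := Z j) (q := Submodule.map (B j).mkQ (Z j))
            fun z hz => Submodule.mem_map_of_mem hz)
          (Submodule.inclusion_injective _)
          (by
            rintro ⟨_, z, hz, rfl⟩
            exact ⟨⟨z, hz⟩, rfl⟩)
          (fun z => by
            rw [← Subtype.coe_inj]
            change (B j).mkQ z = 0 ↔ _
            rw [Submodule.mkQ_apply, Submodule.Quotient.mk_eq_zero]
            exact ⟨fun h => ⟨⟨z, h⟩, rfl⟩, by rintro ⟨x, rfl⟩; exact x.2⟩)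
          ih ExtFinite.of_finite
      have hG : ExtFinite (ModuleCat.of R (R ⧸ I)) (↥(LinearMap.range (G.proj j))) :=
        ExtFinite.of_retract (LinearMap.range (G.proj j)).subtype (G.proj j).rangeRestrict
          (fun x => Subtype.ext (hproj x.2)) hV
      exact ExtFinite.right (Submodule.inclusion inf_le_left)
        (d.restrict (p := LinearMap.range (G.proj j)) (q := (LinearMap.range (G.proj j)).map d)
          fun z hz => Submodule.mem_map_of_mem hz)
        (Submodule.inclusion_injective _)
        (by
          rintro ⟨_, z, hz, rfl⟩
          exact ⟨⟨z, hz⟩, rfl⟩)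
        (fun z => by
          rw [← Subtype.coe_inj]
          change d z = 0 ↔ _
          exact ⟨fun h => ⟨⟨z, z.2, h⟩, rfl⟩, by rintro ⟨x, rfl⟩; exact x.2.2⟩)
        hZ hG
  obtain ⟨n, hn⟩ := G.exists_sum
  have hFG : (⨆ j ∈ Finset.range n, (Z j).map (LinearMap.range d).mkQ).FG := by
    refine Submodule.fg_biSup _ _ fun j _ => ?_
    have h := (hS j (hB j)).map ((B j).liftQ (LinearMap.range d).mkQ (by simpa using hBd j))
    rwa [← Submodule.map_comp, Submodule.liftQ_mkQ] at h
  have := isNoetherian_of_fg_of_noetherian _ hFG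
  refine Submodule.FG.of_le_of_isNoetherian
    (T := ⨆ j ∈ Finset.range n, (Z j).map (LinearMap.range d).mkQ) ?_
  rintro _ ⟨z, hz, rfl⟩
  rw [← hn n le_rfl z, map_sum]
  refine Submodule.sum_mem _ fun j hj => ?_
  refine Submodule.mem_iSup_of_mem j (Submodule.mem_iSup_of_mem hj (Submodule.mem_map_of_mem ?_))
  exact ⟨⟨z, rfl⟩, by
    rw [SetLike.mem_coe, LinearMap.mem_ker, ← G.proj_succ_d, LinearMap.mem_ker.mp hz, map_zero]⟩

end ExtFinite

end Differential

lemma ringKrullDim_quotient_eq_iSup {R : Type*} [CommRing R] (J : Ideal R) :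
    ringKrullDim (R ⧸ J) =
      ⨆ p ∈ PrimeSpectrum.zeroLocus (J : Set R), ringKrullDim (R ⧸ p.asIdeal) := by
  apply le_antisymm
  · rw [ringKrullDim_quotient, Order.krullDim]
    refine iSup_le fun c => le_trans ?_ (le_iSup₂ c.head.1 c.head.2)
    rw [ringKrullDim_quotient, Order.krullDim]
    refine le_iSup_of_le ⟨c.length, fun i => ⟨(c i).1, fun x hx => ?_⟩, c.step⟩ le_rfl
    exact LTSeries.head_le c i hx
  · exact iSup₂_le fun p hp => ringKrullDim_le_of_surjective (Ideal.Quotient.factor hp)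
      (Ideal.Quotient.factor_surjective hp)

theorem dim_eq_of_cofinite (R : Type) [CommRing R] [IsNoetherianRing R] [IsLocalRing R]
    [IsAdicComplete (IsLocalRing.maximalIdeal R) R]
    (I : Ideal R) (M : Type) [AddCommGroup M] [Module R M] [Nontrivial M]
    (hM : IsCofinite R I M) :
    ringKrullDim (R ⧸ (I + Module.annihilator R M)) = moduleDim R M := by
  obtain ⟨S, hS⟩ := IsNoetherian.noetherian I
  have hl : Ideal.span {a | a ∈ S.toList} = I := by simpa using hS
  obtain ⟨p, hp⟩ := Module.nonempty_support_of_nontrivial (R := R) (M := M)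
  have hI : I ≤ IsLocalRing.maximalIdeal R :=
    le_trans (hM.1 hp) (IsLocalRing.le_maximalIdeal p.2.ne_top)
  have hext : Differential.ExtFinite (ModuleCat.of R (R ⧸ I))
      (Differential.Obj.ofModule R M).carrier :=
    fun i => Differential.finite_abelianExt _ _ i (hM.2 i)
  have hfin := Differential.finiteHomology_of_extFinite
    (Differential.koszul S.toList (Differential.Obj.ofModule R M)).d_d
    (Differential.Grading.koszul S.toList (Differential.Grading.ofModule R M))
    (fun a ha => Differential.killsHomology_koszul S.toList _ (hl ▸ ha))
    (Differential.ExtFinite.koszul S.toList _ hext)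
  have hsupp : Module.support R M =
      PrimeSpectrum.zeroLocus ((I + Module.annihilator R M : Ideal R) : Set R) := by
    rw [Differential.support_eq_zeroLocus_of_finiteHomology (IsLocalRing.maximalIdeal R) S.toList
      (fun a ha => hI (hl ▸ Ideal.subset_span ha))
      (by
        rw [← PrimeSpectrum.zeroLocus_span, hl]
        exact hM.1) hfin]
    rw [Ideal.add_eq_sup, PrimeSpectrum.zeroLocus_sup, PrimeSpectrum.zeroLocus_union,
      ← PrimeSpectrum.zeroLocus_span {a | a ∈ S.toList}, hl]
  rw [ringKrullDim_quotient_eq_iSup, moduleDim, hsupp]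
end
end

section
/- Let $(R,\mathfrak{m})$ be a commutative Noetherian complete local ring, $I$ an ideal of $R$, and $M$ a non-zero $I$-cofinite $R$-module with $\dim_R M = 0$. Then $M$ is an Artinian $R$-module and $\dim R/(I+\operatorname{Ann}_R M) = 0$, i.e., $\operatorname{Rad}(I+\operatorname{Ann}_R M) = \mathfrak{m}$. -/
open CategoryTheory

noncomputable section

section

open IsLocalRing

universe u

instance (R : Type u) [CommRing R] (Y : ModuleCat.{u} R) :
    Limits.PreservesFiniteColimits ((linearYoneda R (ModuleCat.{u} R)).obj Y).rightOp := by
  have : Limits.PreservesFiniteLimits ((linearYoneda R (ModuleCat.{u} R)).obj Y) := by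
    have : Limits.PreservesFiniteLimits ((linearYoneda R (ModuleCat.{u} R)).obj Y ⋙ forget _) := by
      change Limits.PreservesFiniteLimits (yoneda.obj Y)
      infer_instance
    exact Limits.preservesFiniteLimits_of_reflects_of_preserves _ (forget _)
  exact Limits.preservesFiniteColimits_rightOp _

/-- `Ext⁰(X, Y)` is `Hom(X, Y)`. -/
def extZeroIso (R : Type u) [CommRing R] (X Y : ModuleCat.{u} R) :
    ((Ext R (ModuleCat.{u} R) 0).obj (Opposite.op X)).obj Y ≅ ModuleCat.of R (X ⟶ Y) :=
  ((((linearYoneda R (ModuleCat.{u} R)).obj Y).rightOp.leftDerivedZeroIsoSelf).app X).unop.symm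

/-- If every element of `M` is killed by a power of `a` and the `a`-torsion of `M` is Artinian,
then `M` is Artinian. -/
theorem isArtinian_of_torsionBy {R M : Type*} [CommRing R] [AddCommGroup M] [Module R M] (a : R)
    (ha : ∀ x : M, ∃ n : ℕ, a ^ n • x = 0) [IsArtinian R (Submodule.torsionBy R M a)] :
    IsArtinian R M := by
  let g : ℕ → Submodule R M → Submodule R (Submodule.torsionBy R M a) := fun j N ↦
    (N.map (LinearMap.lsmul R M (a ^ j))).comap (Submodule.torsionBy R M a).subtype
  have g_mono (j) {N N' : Submodule R M} (h : N ≤ N') : g j N ≤ g j N' :=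
    Submodule.comap_mono (Submodule.map_mono h)
  have g_anti {i j} (h : i ≤ j) (N : Submodule R M) : g j N ≤ g i N := by
    rintro x ⟨y, hy, hxy⟩
    refine ⟨a ^ (j - i) • y, N.smul_mem _ hy, ?_⟩
    simpa [smul_smul, ← pow_add, h] using hxy
  have key {N N' : Submodule R M} (hle : N' ≤ N) (h : ∀ j, g j N ≤ g j N') : N ≤ N' := by
    have (n : ℕ) : ∀ x ∈ N, a ^ n • x = 0 → x ∈ N' := by
      induction n with
      | zero => intro x _ h0; simp_all
      | succ n ih =>
        intro x hx h0
        have hmem : a ^ n • x ∈ Submodule.torsionBy R M a := by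
          simpa [smul_smul, ← pow_succ'] using h0
        obtain ⟨y, hy, hxy⟩ := h n (show ⟨a ^ n • x, hmem⟩ ∈ g n N from ⟨x, hx, rfl⟩)
        have hxy' : a ^ n • y = a ^ n • x := hxy
        have := ih (x - y) (N.sub_mem hx (hle hy)) (by rw [smul_sub, hxy', sub_self])
        simpa using N'.add_mem this hy
    intro x hx
    obtain ⟨n, hn⟩ := ha x
    exact this n x hx hn
  rw [← monotone_stabilizes_iff_artinian]
  intro f
  have f_anti {i j} (h : i ≤ j) : OrderDual.ofDual (f j) ≤ OrderDual.ofDual (f i) := f.monotone h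
  obtain ⟨n₀, hn₀⟩ := IsArtinian.monotone_stabilizes (R := R) (M := Submodule.torsionBy R M a)
    ⟨fun n ↦ OrderDual.toDual (g n (OrderDual.ofDual (f n))), fun i j h ↦
      OrderDual.toDual_le_toDual.mpr ((g_anti h _).trans (g_mono _ (f_anti h)))⟩
  have diag (i j) (hi : n₀ ≤ i) (hj : n₀ ≤ j) : g j (OrderDual.ofDual (f i)) =
      g n₀ (OrderDual.ofDual (f n₀)) := by
    apply le_antisymm ((g_anti hj _).trans (g_mono _ (f_anti hi)))
    have := hn₀ (max i j) (hi.trans (le_max_left _ _))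
    refine (OrderDual.toDual.injective this).le.trans ?_
    exact (g_anti (le_max_right i j) _).trans (g_mono _ (f_anti (le_max_left i j)))
  choose n hn using fun j ↦ IsArtinian.monotone_stabilizes (R := R)
    (M := Submodule.torsionBy R M a) ⟨fun i ↦ OrderDual.toDual (g j (OrderDual.ofDual (f i))),
      fun i i' h ↦ OrderDual.toDual_le_toDual.mpr (g_mono _ (f_anti h))⟩
  have hn' (j i) (h : n j ≤ i) : g j (OrderDual.ofDual (f (n j))) = g j (OrderDual.ofDual (f i)) :=
    OrderDual.toDual.injective (hn j i h)
  let N := max n₀ ((Finset.range n₀).sup n)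
  refine ⟨N, fun m hm ↦ OrderDual.ofDual.injective (le_antisymm ?_ (f_anti hm))⟩
  refine key (f_anti hm) fun j ↦ ?_
  by_cases hj : n₀ ≤ j
  · rw [diag N j (le_max_left _ _) hj, diag m j ((le_max_left _ _).trans hm) hj]
  · have : n j ≤ N := (Finset.le_sup (f := n) (by simpa using hj)).trans (le_max_right _ _)
    rw [← hn' j N this, ← hn' j m (this.trans hm)]

/-- Melkersson's criterion: if every element of `M` is killed by a power of each `a ∈ s` and the
`s`-torsion of `M` is Artinian, then `M` is Artinian. -/
theorem isArtinian_of_torsionBySet {R : Type*} [CommRing R] (s : Finset R) :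
    ∀ {M : Type*} [AddCommGroup M] [Module R M] (_ : ∀ a ∈ s, ∀ x : M, ∃ n : ℕ, a ^ n • x = 0)
    (_ : IsArtinian R (Submodule.torsionBySet R M (s : Set R))), IsArtinian R M := by
  classical
  induction s using Finset.induction_on with
  | empty =>
    intro M _ _ _ h
    refine isArtinian_of_injective (LinearMap.codRestrict
      (Submodule.torsionBySet R M ↑(∅ : Finset R)) LinearMap.id (by simp))
      fun x y h ↦ congrArg Subtype.val h
  | insert a s _ ih =>
    intro M _ _ hs h
    have : IsArtinian R (Submodule.torsionBy R M a) := by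
      refine ih (fun b hb x ↦ ?_) ?_
      · obtain ⟨n, hn⟩ := hs b (by simp [hb]) x
        exact ⟨n, Subtype.ext hn⟩
      · refine isArtinian_of_injective (LinearMap.codRestrict
          (Submodule.torsionBySet R M ↑(insert a s : Finset R))
          ((Submodule.torsionBy R M a).subtype ∘ₗ (Submodule.torsionBySet R _ (s : Set R)).subtype)
          ?_) ?_
        · rintro ⟨⟨x, hx⟩, hx'⟩
          simp only [Submodule.mem_torsionBySet_iff, Submodule.mem_torsionBy_iff] at hx hx' ⊢
          rintro ⟨b, hb⟩
          rcases Finset.mem_insert.mp hb with rfl | hb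
          · exact hx
          · exact congrArg Subtype.val (hx' ⟨b, hb⟩)
        · intro x y h
          have h' := congrArg Subtype.val h
          exact Subtype.ext (Subtype.ext h')
    exact isArtinian_of_torsionBy a (hs a (by simp))

/-- A linear map `f` into an injective module factors through every `g` with `ker g ≤ ker f`. -/
theorem Module.Injective.exists_comp_eq {R : Type u} [CommRing R] {Q N P : Type u}
    [AddCommGroup Q] [Module R Q] [AddCommGroup N] [Module R N] [AddCommGroup P] [Module R P]
    [Module.Injective R Q] (f : N →ₗ[R] Q) (g : N →ₗ[R] P) (h : LinearMap.ker g ≤ LinearMap.ker f) :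
    ∃ k : P →ₗ[R] Q, k ∘ₗ g = f := by
  obtain ⟨k, hk⟩ := Module.Injective.out ((LinearMap.ker g).liftQ g le_rfl)
    (LinearMap.ker_eq_bot.mp (Submodule.ker_liftQ_eq_bot _ _ _ le_rfl))
    ((LinearMap.ker g).liftQ f h)
  exact ⟨k, LinearMap.ext fun x ↦ by simpa using hk (Submodule.Quotient.mk x)⟩

open Submodule in
/-- Every submodule of an injective module has an injective essential extension inside it. -/
theorem Module.Injective.exists_essential {R : Type u} [CommRing R] {Q : Type u}
    [AddCommGroup Q] [Module R Q] [Module.Injective R Q] (K : Submodule R Q) :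
    ∃ E : Submodule R Q, K ≤ E ∧ Module.Injective R E ∧
      ∀ N ≤ E, Disjoint K N → N = ⊥ := by
  obtain ⟨L, -, hL⟩ := zorn_le_nonempty₀ {L : Submodule R Q | Disjoint K L} (fun c hc hchain y hy ↦
    ⟨sSup c, by
      have := (DirectedOn.disjoint_sSup_right (a := K) hchain.directedOn).mpr hc
      exact this, fun z hz ↦ le_sSup hz⟩) ⊥ disjoint_bot_right
  obtain ⟨E, hKE, hE⟩ := zorn_le_nonempty₀ {E : Submodule R Q | Disjoint E L}
    (fun c hc hchain y hy ↦
    ⟨sSup c, by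
      have := (DirectedOn.disjoint_sSup_left (a := L) hchain.directedOn).mpr hc
      exact this, fun z hz ↦ le_sSup hz⟩) K hL.prop
  have hKL : Disjoint K L := hL.prop
  have hEL : Disjoint E L := hE.prop
  have hLmax {N : Submodule R Q} (hN : L ≤ N) (h : Disjoint K N) : N ≤ L := hL.le_of_ge h hN
  obtain ⟨f, hf⟩ := Module.Injective.exists_comp_eq (E.subtype ∘ₗ LinearMap.fst R E L)
    (E.subtype.coprod L.subtype) (by
      rintro ⟨⟨x, hx⟩, ⟨y, hy⟩⟩ h
      have h' : x + y = 0 := by simpa using h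
      have : x ∈ L := by rw [eq_neg_of_add_eq_zero_left h']; exact L.neg_mem hy
      simpa using disjoint_def.mp hEL x hx this)
  have hfE (x) (hx : x ∈ E) : f x = x := by simpa using LinearMap.congr_fun hf (⟨x, hx⟩, 0)
  have hfL (x) (hx : x ∈ L) : f x = 0 := by simpa using LinearMap.congr_fun hf (0, ⟨x, hx⟩)
  have hcomap : L.comap f ≤ L := hLmax (fun x hx ↦ by simp [hfL x hx]) <|
    disjoint_def.mpr fun x hx hx' ↦ disjoint_def.mp hKL x hx <| by
      rw [mem_comap, hfE x (hKE hx)] at hx'; exact hx'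
  have hrange : LinearMap.range f ≤ E := by
    refine hE.le_of_ge (disjoint_def.mpr ?_) fun x hx ↦ ⟨x, hfE x hx⟩
    rintro _ ⟨x, rfl⟩ hx
    exact hfL x (hcomap hx)
  refine ⟨E, hKE, ⟨fun X Y _ _ _ _ i hi g ↦ ?_⟩, fun N hN h ↦ ?_⟩
  · obtain ⟨k, hk⟩ := Module.Injective.out i hi (E.subtype ∘ₗ g)
    refine ⟨(f ∘ₗ k).codRestrict E fun x ↦ hrange ⟨_, rfl⟩, fun x ↦ Subtype.ext ?_⟩
    simp [hk, hfE]
  · have hNL : N ⊔ L ≤ L := hLmax le_sup_right <| disjoint_def.mpr fun x hx hx' ↦ by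
      obtain ⟨y, hy, z, hz, rfl⟩ := mem_sup.mp hx'
      have : z = 0 := disjoint_def.mp hEL z (by simpa using E.sub_mem (hKE hx) (hN hy)) hz
      subst this
      exact disjoint_def.mp h _ hx (by simpa using hy)
    rw [eq_bot_iff]
    exact fun x hx ↦ disjoint_def.mp hEL x (hN hx) (hNL (mem_sup_left hx))

/-- There is an injective module `E` whose socle is generated by one nonzero element `e`
(an injective hull of the residue field). -/
theorem exists_injective_hull_residueField (R : Type u) [CommRing R] [IsLocalRing R] :
    ∃ (E : ModuleCat.{u} R) (_ : Module.Injective R E) (e : E), e ≠ 0 ∧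
      (∀ r ∈ maximalIdeal R, r • e = 0) ∧
      ∀ x : E, (∀ r ∈ maximalIdeal R, r • x = 0) → ∃ r : R, x = r • e := by
  obtain ⟨⟨Q, hQ, i, hi⟩⟩ := EnoughInjectives.presentation (ModuleCat.of R (ResidueField R))
  have : Module.Injective R Q := Module.injective_module_of_injective_object R Q
  have hi' : Function.Injective i := (ModuleCat.mono_iff_injective i).mp hi
  obtain ⟨E, hKE, hE, hess⟩ := Module.Injective.exists_essential (LinearMap.range i.hom)
  let e : E := ⟨i.hom (1 : ResidueField R), hKE ⟨_, rfl⟩⟩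
  have hne : e ≠ 0 := fun h ↦ one_ne_zero (α := ResidueField R) <|
    hi' ((congrArg Subtype.val h).trans (map_zero i.hom).symm)
  have he (r : R) : r • e = ⟨i.hom (residue R r), hKE ⟨_, rfl⟩⟩ := by
    refine Subtype.ext ?_
    change r • i.hom (1 : ResidueField R) = i.hom (residue R r)
    rw [← map_smul]
    congr 1
    exact (Algebra.algebraMap_eq_smul_one r).symm
  refine ⟨ModuleCat.of R E, hE, e, hne, fun r hr ↦ ?_, fun x hx ↦ ?_⟩
  · change r • e = 0
    rw [he]
    have : residue R r = 0 := (residue_eq_zero_iff r).mpr hr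
    ext
    rw [this]
    exact map_zero i.hom
  · by_cases h0 : x = 0
    · exact ⟨0, by simp [h0]⟩
    obtain ⟨x, hxE⟩ := x
    have : ¬ Disjoint (LinearMap.range i.hom) (R ∙ x) := fun h ↦ h0 <| by
      have := hess _ ((Submodule.span_singleton_le_iff_mem _ _).mpr hxE) h
      exact Subtype.ext (Submodule.span_singleton_eq_bot.mp this)
    rw [Submodule.disjoint_def] at this
    push Not at this
    obtain ⟨_, ⟨k, rfl⟩, hk, hk0⟩ := this
    obtain ⟨r, hr⟩ := Submodule.mem_span_singleton.mp hk
    obtain ⟨s, rfl⟩ := residue_surjective (R := R) k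
    have hu : IsUnit r := by
      by_contra h
      exact hk0 (hr ▸ congrArg Subtype.val (hx r h))
    obtain ⟨u, rfl⟩ := hu
    refine ⟨(u⁻¹ : Rˣ) * s, ?_⟩
    rw [mul_smul]
    change _ = (u⁻¹ : Rˣ).val • (s • e)
    rw [he]
    refine Subtype.ext ?_
    change x = (u⁻¹ : Rˣ).val • (i.hom (residue R s))
    simp [← hr, smul_smul]

/-- A linear map into an injective module that vanishes on the common torsion of the `b i` is a
linear combination of the multiplications by the `b i`. -/
theorem Module.Injective.exists_eq_sum_smul {R : Type u} [CommRing R] {Q N P : Type u} {ι : Type}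
    [AddCommGroup Q] [Module R Q] [AddCommGroup N] [Module R N] [AddCommGroup P] [Module R P]
    [Module.Injective R Q] [Fintype ι] (b : ι → R) (j : N →ₗ[R] P) (f : N →ₗ[R] Q)
    (h : ∀ x, (∀ i, b i • j x = 0) → f x = 0) :
    ∃ k : ι → P →ₗ[R] Q, ∀ x, f x = ∑ i, k i (b i • j x) := by
  classical
  obtain ⟨k, hk⟩ := Module.Injective.exists_comp_eq f (LinearMap.pi fun i ↦ b i • j) fun x hx ↦
    h x fun i ↦ congrFun hx i
  refine ⟨fun i ↦ k ∘ₗ LinearMap.single R (fun _ ↦ P) i, fun x ↦ ?_⟩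
  simp only [← hk, LinearMap.comp_apply, LinearMap.single_apply, ← map_sum]
  exact congrArg k (Finset.univ_sum_single fun i ↦ b i • j x).symm

theorem exists_finite_generators {R : Type*} [CommRing R] [IsNoetherianRing R] (I : Ideal R) :
    ∃ (n : ℕ) (b : Fin n → R), Ideal.span (Set.range b) = I :=
  Submodule.fg_iff_exists_fin_generating_family.mp (IsNoetherian.noetherian I)

theorem smul_eq_zero_of_span {R : Type*} [CommRing R] {M : Type*} [AddCommGroup M] [Module R M]
    {s : Set R} {x : M} (h : ∀ a ∈ s, a • x = 0) {a : R} (ha : a ∈ Ideal.span s) : a • x = 0 := by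
  have : Ideal.span s ≤ Ideal.torsionOf R M x := Ideal.span_le.mpr h
  exact this ha

/-- Over a complete local ring, an endomorphism of an injective module with simple socle acts on
the `𝔪`-power torsion as multiplication by a scalar. -/
theorem exists_eq_smul_of_torsion {R : Type u} [CommRing R] [IsNoetherianRing R] [IsLocalRing R]
    [IsAdicComplete (maximalIdeal R) R] {E : Type u} [AddCommGroup E] [Module R E]
    [Module.Injective R E] {e : E} (he : ∀ r ∈ maximalIdeal R, r • e = 0)
    (hsoc : ∀ x : E, (∀ r ∈ maximalIdeal R, r • x = 0) → ∃ r : R, x = r • e) (f : E →ₗ[R] E) :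
    ∃ r : R, ∀ (n : ℕ) (x : E), (∀ a ∈ maximalIdeal R ^ n, a • x = 0) → f x = r • x := by
  have scalar (g : E →ₗ[R] E) :
      ∃ c : R, ∀ x : E, (∀ r ∈ maximalIdeal R, r • x = 0) → g x = c • x := by
    obtain ⟨c, hc⟩ := hsoc (g e) fun r hr ↦ by rw [← map_smul, he r hr, map_zero]
    refine ⟨c, fun x hx ↦ ?_⟩
    obtain ⟨r, rfl⟩ := hsoc x hx
    rw [map_smul, hc, smul_comm]
  let P (n : ℕ) (r : R) : Prop :=
    ∀ x : E, (∀ a ∈ maximalIdeal R ^ n, a • x = 0) → f x = r • x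
  have step (n : ℕ) (r : R) (hr : P n r) : ∃ r', P (n + 1) r' ∧ r' - r ∈ maximalIdeal R ^ n := by
    obtain ⟨k, b, hb⟩ := exists_finite_generators (maximalIdeal R ^ n)
    have hbmem (i) : b i ∈ maximalIdeal R ^ n := hb ▸ Ideal.subset_span ⟨i, rfl⟩
    obtain ⟨g, hg⟩ := Module.Injective.exists_eq_sum_smul b LinearMap.id (f - r • LinearMap.id)
      fun x hx ↦ by
        simpa [sub_eq_zero] using hr x fun a ha ↦
          smul_eq_zero_of_span (by simpa using hx) (hb.symm ▸ ha)
    choose c hc using fun i ↦ scalar (g i)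
    refine ⟨r + ∑ i, c i * b i, fun x hx ↦ ?_, ?_⟩
    · have : f x - r • x = ∑ i, g i (b i • x) := by simpa using hg x
      rw [add_smul, ← sub_eq_iff_eq_add', this, Finset.sum_smul]
      refine Finset.sum_congr rfl fun i _ ↦ ?_
      rw [hc i (b i • x) fun s hs ↦ ?_, mul_smul]
      rw [smul_smul]
      exact hx _ (by rw [pow_succ']; exact Ideal.mul_mem_mul hs (hbmem i))
    · simpa using Ideal.sum_mem _ fun i _ ↦ Ideal.mul_mem_left _ _ (hbmem i)
  choose! next hnext hsub using step
  let r : ℕ → R := fun n ↦ Nat.rec 0 (fun n s ↦ next n s) n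
  have hr (n : ℕ) : P n (r n) := by
    induction n with
    | zero =>
      intro x hx
      have : x = 0 := by simpa using hx 1 (by simp)
      simp [this]
    | succ n ih => exact hnext n _ ih
  have hcauchy {m n : ℕ} (h : m ≤ n) : r n - r m ∈ maximalIdeal R ^ m := by
    induction n, h using Nat.le_induction with
    | base => simp
    | succ n hmn ih =>
      have := Ideal.add_mem _ (Ideal.pow_le_pow_right hmn (hsub n _ (hr n))) ih
      simpa [r] using this
  obtain ⟨L, hL⟩ := IsPrecomplete.prec' (I := maximalIdeal R) r fun {m n} h ↦ by
    rw [SModEq.sub_mem, ← neg_sub]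
    simpa using neg_mem (hcauchy h)
  refine ⟨L, fun n x hx ↦ ?_⟩
  have h := hL n
  rw [SModEq.sub_mem] at h
  have := hx _ (by simpa using h)
  rw [hr n x hx, ← sub_eq_zero, ← sub_smul, this]

/-- An Artinian module embeds into a finite power of an injective module containing the residue
field. -/
theorem exists_injective_pi {R : Type u} [CommRing R] [IsLocalRing R] {E : Type u} [AddCommGroup E]
    [Module R E] [Module.Injective R E] {e : E} (hne : e ≠ 0)
    (he : ∀ r ∈ maximalIdeal R, r • e = 0) (M : Type u) [AddCommGroup M] [Module R M]
    [IsArtinian R M] :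
    ∃ (n : ℕ) (j : M →ₗ[R] (Fin n → E)), Function.Injective j := by
  have cogen {v : M} (hv : v ≠ 0) : ∃ f : M →ₗ[R] E, f v ≠ 0 := by
    obtain ⟨f, hf⟩ := Module.Injective.exists_comp_eq (LinearMap.toSpanSingleton R E e)
      (LinearMap.toSpanSingleton R M v) fun r hr ↦ by
        refine he r fun hu ↦ hv ?_
        exact hu.smul_eq_zero.mp (by simpa using hr)
    refine ⟨f, ?_⟩
    have := LinearMap.congr_fun hf 1
    simp only [LinearMap.comp_apply, LinearMap.toSpanSingleton_apply, one_smul] at this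
    rwa [this]
  obtain ⟨_, ⟨n, j, rfl⟩, hmin⟩ := IsArtinian.set_has_minimal (R := R) (M := M)
    {N | ∃ (n : ℕ) (j : M →ₗ[R] (Fin n → E)), N = LinearMap.ker j} ⟨_, 0, 0, rfl⟩
  refine ⟨n, j, LinearMap.ker_eq_bot.mp <| (Submodule.eq_bot_iff _).mpr fun v hv ↦ ?_⟩
  by_contra h0
  obtain ⟨f, hf⟩ := cogen h0
  refine hmin _ ⟨n + 1, LinearMap.pi (Fin.cons f fun i ↦ LinearMap.proj i ∘ₗ j), rfl⟩ ?_
  refine lt_of_le_of_ne (fun x hx ↦ ?_) fun h ↦ ?_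
  · rw [LinearMap.mem_ker] at hx ⊢
    ext i
    simpa using congrFun hx i.succ
  · rw [← h] at hv
    exact hf (by simpa using congrFun hv 0)

/-- If `x` kills the `I`-torsion of an Artinian `𝔪`-power torsion module `M` over a complete local
ring, then a power of `x` lies in `I + Ann M`. -/
theorem exists_pow_mem_sup_annihilator {R : Type u} [CommRing R] [IsNoetherianRing R] [IsLocalRing R]
    [IsAdicComplete (maximalIdeal R) R] (I : Ideal R) (M : Type u) [AddCommGroup M] [Module R M]
    [IsArtinian R M] (htors : ∀ u : M, ∃ n : ℕ, ∀ a ∈ maximalIdeal R ^ n, a • u = 0) {x : R}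
    (hx : ∀ u : M, (∀ a ∈ I, a • u = 0) → x • u = 0) :
    ∃ n : ℕ, x ^ n ∈ I + Module.annihilator R M := by
  obtain ⟨E, _, e, hne, he, hsoc⟩ := exists_injective_hull_residueField R
  obtain ⟨g, j, hj⟩ := exists_injective_pi hne he M
  obtain ⟨k, b, hb⟩ := exists_finite_generators I
  have hbmem (i) : b i ∈ I := hb ▸ Ideal.subset_span ⟨i, rfl⟩
  have hfac (l : Fin g) := Module.Injective.exists_eq_sum_smul b j (LinearMap.proj l ∘ₗ (x • j))
    fun u hu ↦ by
      have : x • u = 0 := hx u fun a ha ↦ smul_eq_zero_of_span (s := Set.range b) (by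
        rintro _ ⟨i, rfl⟩
        exact hj (by rw [map_smul, hu i, map_zero])) (hb.symm ▸ ha)
      have hj0 : x • j u = 0 := by rw [← map_smul, this, map_zero]
      exact congrFun hj0 l
  choose f hf using hfac
  choose c hc using fun l i m ↦ exists_eq_smul_of_torsion he hsoc
    (f l i ∘ₗ LinearMap.single R (fun _ ↦ (E : Type u)) m)
  let B : Matrix (Fin g) (Fin g) R := .of fun l m ↦ ∑ i, c l i m * b i
  have hB (u : M) (l : Fin g) : x • j u l = ∑ m, B l m • j u m := by
    obtain ⟨n, hn⟩ := htors u
    have h := hf l u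
    simp only [LinearMap.comp_apply, LinearMap.smul_apply, LinearMap.proj_apply, Pi.smul_apply] at h
    rw [h]
    simp only [B, Matrix.of_apply, Finset.sum_smul]
    rw [Finset.sum_comm]
    refine Finset.sum_congr rfl fun i _ ↦ ?_
    rw [← Finset.univ_sum_single (b i • j u), map_sum]
    refine Finset.sum_congr rfl fun m _ ↦ ?_
    have := hc l i m n (b i • j u m) fun a ha ↦ by
      have : a • j u = 0 := by rw [← map_smul, hn a ha, map_zero]
      rw [smul_comm, show a • j u m = 0 from congrFun this m, smul_zero]
    rw [mul_smul, ← this]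
    rfl
  let A : Matrix (Fin g) (Fin g) R := Matrix.scalar _ x - B
  have hdet : A.det ∈ Module.annihilator R M := by
    rw [Module.mem_annihilator]
    intro u
    refine hj ?_
    have hA (l : Fin g) : ∑ m, A l m • j u m = 0 := by
      simp [A, sub_smul, ← hB, Matrix.diagonal_apply, ite_smul]
    ext l
    have hadj (m : Fin g) : ∑ i, A.adjugate l i * A i m = if l = m then A.det else 0 := by
      rw [← Matrix.mul_apply, Matrix.adjugate_mul, Matrix.smul_apply, Matrix.one_apply]
      simp
    calc
      (j (A.det • u)) l = ∑ m, (∑ i, A.adjugate l i * A i m) • j u m := by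
        simp [hadj, ite_smul]
      _ = ∑ i, A.adjugate l i • ∑ m, A i m • j u m := by
        simp only [Finset.sum_smul, Finset.smul_sum, mul_smul]
        exact Finset.sum_comm
      _ = (j 0) l := by simp [hA]
  refine ⟨g, ?_⟩
  have hmod : x ^ g - A.det ∈ I := by
    have hAI : (Ideal.Quotient.mk I).mapMatrix A = Matrix.scalar _ (Ideal.Quotient.mk I x) := by
      ext l m
      have hBI : Ideal.Quotient.mk I (B l m) = 0 := Ideal.Quotient.eq_zero_iff_mem.mpr
        (Ideal.sum_mem _ fun i _ ↦ Ideal.mul_mem_left _ (c l i m) (hbmem i) :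
          ∑ i, c l i m * b i ∈ I)
      by_cases hlm : l = m
      · subst hlm
        simp [A, hBI]
      · simp [A, hBI, hlm]
    rw [← Ideal.Quotient.eq, RingHom.map_det, hAI]
    simp
  rw [← sub_add_cancel (x ^ g) A.det]
  exact Submodule.add_mem_sup hmod hdet

theorem IsCofinite.finite_torsionBySet {R : Type} [CommRing R] {I : Ideal R} {M : Type}
    [AddCommGroup M] [Module R M] (h : IsCofinite R I M) :
    Module.Finite R (Submodule.torsionBySet R M (I : Set R)) := by
  have := h.2 0
  have : Module.Finite R ((R ⧸ I) →ₗ[R] M) :=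
    Module.Finite.equiv
      ((extZeroIso R (ModuleCat.of R (R ⧸ I)) (ModuleCat.of R M)).toLinearEquiv ≪≫ₗ
        ModuleCat.homLinearEquiv)
  refine Module.Finite.of_surjective ((LinearMap.applyₗ (1 : R ⧸ I)).codRestrict
    (Submodule.torsionBySet R M (I : Set R)) fun f ↦ ?_) fun x ↦ ?_
  · rw [Submodule.mem_torsionBySet_iff]
    rintro ⟨a, ha⟩
    change a • f 1 = 0
    rw [← map_smul, Algebra.smul_def, mul_one, Ideal.Quotient.algebraMap_eq,
      Ideal.Quotient.eq_zero_iff_mem.mpr ha, map_zero]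
  · refine ⟨Submodule.liftQ I (LinearMap.toSpanSingleton R M x) fun a ha ↦ ?_, Subtype.ext ?_⟩
    · simpa using (Submodule.mem_torsionBySet_iff _ _).mp x.2 ⟨a, ha⟩
    · change LinearMap.toSpanSingleton R M x 1 = x
      simp

theorem eq_maximalIdeal_of_mem_support {R : Type} [CommRing R] [IsLocalRing R] {M : Type}
    [AddCommGroup M] [Module R M] (hdim : moduleDim R M = 0) {p : PrimeSpectrum R}
    (hp : p ∈ Module.support R M) :
    p.asIdeal = maximalIdeal R := by
  have h : ringKrullDim (R ⧸ p.asIdeal) ≤ 0 :=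
    hdim ▸ le_iSup₂ (f := fun (p : PrimeSpectrum R) (_ : p ∈ Module.support R M) ↦
      ringKrullDim (R ⧸ p.asIdeal)) p hp
  have : Ring.KrullDimLE 0 (R ⧸ p.asIdeal) := by
    rwa [Ring.krullDimLE_iff]
  have := Ring.KrullDimLE.isField_of_isDomain (R := R ⧸ p.asIdeal)
  exact eq_maximalIdeal (Ideal.Quotient.maximal_of_isField _ this)

theorem exists_pow_maximalIdeal_smul_eq_zero {R : Type} [CommRing R] [IsNoetherianRing R]
    [IsLocalRing R] {M : Type} [AddCommGroup M] [Module R M] (hdim : moduleDim R M = 0) (u : M) :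
    ∃ n : ℕ, ∀ a ∈ maximalIdeal R ^ n, a • u = 0 := by
  have hle : maximalIdeal R ≤ (Ideal.torsionOf R M u).radical := by
    rw [Ideal.radical_eq_sInf]
    refine le_sInf fun p ⟨hp, hprime⟩ ↦ ?_
    refine (eq_maximalIdeal_of_mem_support (p := ⟨p, hprime⟩) hdim
      (Module.mem_support_iff_exists_annihilator.mpr ⟨u, fun a ha ↦ hp ?_⟩)).ge
    exact (Submodule.mem_annihilator_span_singleton u a).mp ha
  obtain ⟨n, hn⟩ := Ideal.exists_pow_le_of_le_radical_of_fg hle (IsNoetherian.noetherian _)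
  exact ⟨n, fun a ha ↦ hn ha⟩

theorem exists_pow_smul_eq_zero_of_finite {R : Type u} [CommRing R] {J : Ideal R} {M : Type u}
    [AddCommGroup M] [Module R M] (N : Submodule R M) [Module.Finite R N]
    (h : ∀ u : M, ∃ n : ℕ, ∀ a ∈ J ^ n, a • u = 0) :
    ∃ n : ℕ, ∀ a ∈ J ^ n, ∀ u ∈ N, a • u = 0 := by
  obtain ⟨s, rfl⟩ := (Module.Finite.iff_fg (N := N)).mp inferInstance
  choose n hn using h
  refine ⟨s.sup n, fun a ha u hu ↦ ?_⟩
  have : Submodule.span R (s : Set M) ≤ Submodule.torsionBy R M a := Submodule.span_le.mpr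
    fun v hv ↦ hn v a (Ideal.pow_le_pow_right (Finset.le_sup hv) ha)
  exact this hu

theorem isArtinian_of_finite_torsion {R : Type u} [CommRing R] [IsNoetherianRing R] [IsLocalRing R]
    {M : Type u} [AddCommGroup M] [Module R M]
    (htors : ∀ u : M, ∃ n : ℕ, ∀ a ∈ maximalIdeal R ^ n, a • u = 0)
    (h : Module.Finite R (Submodule.torsionBySet R M (maximalIdeal R : Set R))) : IsArtinian R M := by
  obtain ⟨s, hs⟩ := IsNoetherian.noetherian (maximalIdeal R)
  refine isArtinian_of_torsionBySet s (fun a ha u ↦ ?_) ?_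
  · obtain ⟨n, hn⟩ := htors u
    exact ⟨n, hn _ (Ideal.pow_mem_pow (hs ▸ Submodule.subset_span ha) n)⟩
  · rw [Submodule.torsionBySet_eq_torsionBySet_span, Ideal.span, hs]
    have : Module.Finite (R ⧸ maximalIdeal R)
        (Submodule.torsionBySet R M (maximalIdeal R : Set R)) :=
      Module.Finite.of_restrictScalars_finite R _ _
    have : IsArtinianRing (R ⧸ maximalIdeal R) :=
      inferInstanceAs (IsArtinianRing (ResidueField R))
    exact isArtinian_of_surjective_algebraMap (R := R ⧸ maximalIdeal R)
      Ideal.Quotient.mk_surjective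

end

theorem artinian_of_cofinite_dim_zero (R : Type) [CommRing R] [IsNoetherianRing R]
    [IsLocalRing R] [IsAdicComplete (IsLocalRing.maximalIdeal R) R]
    (I : Ideal R) (M : Type) [AddCommGroup M] [Module R M] [Nontrivial M]
    (hM : IsCofinite R I M) (hdim : moduleDim R M = 0) :
    IsArtinian R M ∧ ringKrullDim (R ⧸ (I + Module.annihilator R M)) = 0 ∧
      (I + Module.annihilator R M).radical = IsLocalRing.maximalIdeal R := by
  have htors := exists_pow_maximalIdeal_smul_eq_zero (R := R) (M := M) hdim
  have hfin := hM.finite_torsionBySet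
  obtain ⟨p, hp⟩ := Module.nonempty_support_of_nontrivial (R := R) (M := M)
  have hpm := eq_maximalIdeal_of_mem_support hdim hp
  have hIm : I ≤ IsLocalRing.maximalIdeal R := hpm ▸ hM.1 hp
  have hArt : IsArtinian R M := isArtinian_of_finite_torsion htors <|
    Module.Finite.of_injective
      (Submodule.inclusion (Submodule.torsionBySet_le_torsionBySet_of_subset hIm))
      (Submodule.inclusion_injective _)
  have hle : I + Module.annihilator R M ≤ IsLocalRing.maximalIdeal R :=
    sup_le hIm (hpm ▸ Module.annihilator_le_of_mem_support hp)
  have hrad : (I + Module.annihilator R M).radical = IsLocalRing.maximalIdeal R := by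
    refine le_antisymm ((Ideal.IsPrime.radical_le_iff inferInstance).mpr hle) fun y hy ↦ ?_
    obtain ⟨n, hn⟩ := exists_pow_smul_eq_zero_of_finite
      (Submodule.torsionBySet R M (I : Set R)) htors
    obtain ⟨k, hk⟩ := exists_pow_mem_sup_annihilator I M htors (x := y ^ n) fun u hu ↦
      hn _ (Ideal.pow_mem_pow hy n) u ((Submodule.mem_torsionBySet_iff _ _).mpr fun a ↦ hu a a.2)
    exact ⟨n * k, by rwa [pow_mul]⟩
  refine ⟨hArt, le_antisymm ?_ ?_, hrad⟩
  · rw [← Nat.cast_zero, ← Ring.krullDimLE_iff]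
    refine Ring.KrullDimLE.mk₀ fun P hP ↦ ?_
    have hcomap : P.comap (Ideal.Quotient.mk _) = IsLocalRing.maximalIdeal R := by
      refine le_antisymm (IsLocalRing.le_maximalIdeal (hP.comap _).ne_top) ?_
      rw [← hrad, (hP.comap _).radical_le_iff]
      exact Ideal.mk_ker.symm.le.trans (Ideal.comap_mono bot_le)
    have : (P.comap (Ideal.Quotient.mk _)).IsMaximal :=
      hcomap ▸ IsLocalRing.maximalIdeal.isMaximal R
    rw [← Ideal.map_comap_of_surjective _ Ideal.Quotient.mk_surjective P] at hP ⊢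
    exact (Ideal.map_eq_top_or_isMaximal_of_surjective _ Ideal.Quotient.mk_surjective
      this).resolve_left hP.ne_top
  · have : Nontrivial (R ⧸ (I + Module.annihilator R M)) :=
      Ideal.Quotient.nontrivial_iff.mpr fun h ↦
        (IsLocalRing.maximalIdeal.isMaximal R).ne_top (top_le_iff.mp (h ▸ hle))
    exact ringKrullDim_nonneg_of_nontrivial
end
end

section
/- Let $(R,\mathfrak{m})$ be a commutative Noetherian local domain of Krull dimension at least $1$ such that $H^1_{\mathfrak{m}}(R)$ is not a finitely generated $R$-module. Then $\operatorname{Ann}_R(H^1_{\mathfrak{m}}(R)) = 0$, i.e., $H^1_{\mathfrak{m}}(R)$ is a faithful $R$-module. -/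
open CategoryTheory

noncomputable section

universe u

namespace ExtOne

open Opposite Limits

variable {R : Type u} [CommRing R] {X X' Y : ModuleCat.{u} R}

/-- The complex of morphisms from a projective resolution to `Y`, in the opposite category. -/
abbrev homComplex (P : ProjectiveResolution X) (Y : ModuleCat.{u} R) :
    ChainComplex (ModuleCat.{u} R)ᵒᵖ ℕ :=
  (((linearYoneda R (ModuleCat.{u} R)).obj Y).rightOp.mapHomologicalComplex _).obj P.complex

/-- The map from `1`-cocycles of a projective resolution to `Ext¹`. -/
def cocyclesToExt (P : ProjectiveResolution X) (Y : ModuleCat.{u} R) :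
    ((homComplex P Y).opcycles 1).unop ⟶
      ((Ext R (ModuleCat.{u} R) 1).obj (op X)).obj Y :=
  ((homComplex P Y).homologyι 1).unop ≫
    (P.isoLeftDerivedObj ((linearYoneda R (ModuleCat.{u} R)).obj Y).rightOp 1).hom.unop

/-- The inclusion of `1`-cocycles of a projective resolution in the `1`-cochains. -/
def cocyclesInclusion (P : ProjectiveResolution X) (Y : ModuleCat.{u} R) :
    ((homComplex P Y).opcycles 1).unop ⟶ ModuleCat.of R (P.complex.X 1 ⟶ Y) :=
  ((homComplex P Y).pOpcycles 1).unop

/-- `e` is the class in `Ext¹` of the cocycle `f`. -/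
def IsClass (P : ProjectiveResolution X) (f : P.complex.X 1 ⟶ Y)
    (e : ((Ext R (ModuleCat.{u} R) 1).obj (op X)).obj Y) : Prop :=
  ∃ k, cocyclesToExt P Y k = e ∧ cocyclesInclusion P Y k = f

lemma IsClass.add {P : ProjectiveResolution X} {f f' : P.complex.X 1 ⟶ Y}
    {e e' : ((Ext R (ModuleCat.{u} R) 1).obj (op X)).obj Y} (h : IsClass P f e)
    (h' : IsClass P f' e') : IsClass P (f + f') (e + e') := by
  obtain ⟨k, rfl, rfl⟩ := h
  obtain ⟨k', rfl, rfl⟩ := h'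
  exact ⟨k + k', map_add _ _ _, map_add _ _ _⟩

lemma IsClass.smul {P : ProjectiveResolution X} {f : P.complex.X 1 ⟶ Y}
    {e : ((Ext R (ModuleCat.{u} R) 1).obj (op X)).obj Y} (h : IsClass P f e) (r : R) :
    IsClass P (r • f) (r • e) := by
  obtain ⟨k, rfl, rfl⟩ := h
  exact ⟨r • k, map_smul _ _ _, map_smul _ _ _⟩

lemma exists_isClass_of_ext (P : ProjectiveResolution X)
    (e : ((Ext R (ModuleCat.{u} R) 1).obj (op X)).obj Y) : ∃ f, IsClass P f e := by
  have : Epi (cocyclesToExt P Y) :=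
    epi_comp' (inferInstanceAs (Epi ((homComplex P Y).homologyι 1).unop))
      (inferInstanceAs (Epi
        (P.isoLeftDerivedObj ((linearYoneda R (ModuleCat.{u} R)).obj Y).rightOp 1).unop.hom))
  obtain ⟨k, hk⟩ := (ModuleCat.epi_iff_surjective _).1 this e
  exact ⟨_, k, hk, rfl⟩

lemma d_comp_eq_zero_iff (P : ProjectiveResolution X) (Y : ModuleCat.{u} R)
    (f : P.complex.X 1 ⟶ Y) :
    P.complex.d 2 1 ≫ f = 0 ↔ ∃ k, cocyclesInclusion P Y k = f := by
  exact (ShortComplex.ShortExact.moduleCat_exact_iff_function_exact _).1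
    (ShortComplex.exact_of_g_is_cokernel
      (ShortComplex.mk _ _ ((homComplex P Y).d_pOpcycles 2 1))
      ((homComplex P Y).opcyclesIsCokernel 2 1 (by simp))).unop f

lemma cocyclesToExt_eq_zero_iff (P : ProjectiveResolution X) (Y : ModuleCat.{u} R)
    (k : ((homComplex P Y).opcycles 1).unop) :
    cocyclesToExt P Y k = 0 ↔
      ∃ g : P.complex.X 0 ⟶ Y, P.complex.d 1 0 ≫ g = cocyclesInclusion P Y k := by
  have hexact := (ShortComplex.ShortExact.moduleCat_exact_iff_function_exact _).1
    (ShortComplex.exact_of_f_is_kernel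
      (ShortComplex.mk _ _ ((homComplex P Y).homologyι_comp_fromOpcycles 1 0))
      ((homComplex P Y).homologyIsKernel 1 0 (by simp))).unop
  have hincl : Function.Injective (cocyclesInclusion P Y) :=
    (ModuleCat.mono_iff_injective _).1
      (@CategoryTheory.unop_mono_of_epi _ _ _ _ ((homComplex P Y).pOpcycles 1) inferInstance)
  have hiso : Function.Injective
      (P.isoLeftDerivedObj ((linearYoneda R (ModuleCat.{u} R)).obj Y).rightOp 1).hom.unop := by
    rw [← ModuleCat.mono_iff_injective]
    infer_instance
  have hzero : cocyclesToExt P Y k = 0 ↔ ((homComplex P Y).homologyι 1).unop k = 0 :=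
    ⟨fun h => hiso (h.trans (map_zero _).symm), fun h =>
      (congrArg (P.isoLeftDerivedObj
        ((linearYoneda R (ModuleCat.{u} R)).obj Y).rightOp 1).hom.unop h).trans (map_zero _)⟩
  have hd (g : P.complex.X 0 ⟶ Y) :
      cocyclesInclusion P Y (((homComplex P Y).fromOpcycles 1 0).unop g) =
        P.complex.d 1 0 ≫ g :=
    congr($((homComplex P Y).p_fromOpcycles 1 0).unop g)
  exact hzero.trans ((hexact k).trans (exists_congr fun g =>
    ⟨fun h => (hd g).symm.trans (congrArg _ h), fun h => hincl ((hd g).trans h)⟩))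

lemma IsClass.comp_eq_zero {P : ProjectiveResolution X} {f : P.complex.X 1 ⟶ Y}
    {e : ((Ext R (ModuleCat.{u} R) 1).obj (op X)).obj Y} (h : IsClass P f e) :
    P.complex.d 2 1 ≫ f = 0 := by
  obtain ⟨k, -, hk⟩ := h
  exact (d_comp_eq_zero_iff P Y f).2 ⟨k, hk⟩

lemma exists_isClass (P : ProjectiveResolution X) (f : P.complex.X 1 ⟶ Y)
    (h : P.complex.d 2 1 ≫ f = 0) : ∃ e, IsClass P f e := by
  obtain ⟨k, hk⟩ := (d_comp_eq_zero_iff P Y f).1 h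
  exact ⟨_, k, rfl, hk⟩

lemma IsClass.eq_zero_iff {P : ProjectiveResolution X} {f : P.complex.X 1 ⟶ Y}
    {e : ((Ext R (ModuleCat.{u} R) 1).obj (op X)).obj Y} (h : IsClass P f e) :
    e = 0 ↔ ∃ g : P.complex.X 0 ⟶ Y, P.complex.d 1 0 ≫ g = f := by
  obtain ⟨k, rfl, rfl⟩ := h
  exact cocyclesToExt_eq_zero_iff P Y k

lemma IsClass.map {P : ProjectiveResolution X} {P' : ProjectiveResolution X'}
    {f : P'.complex.X 1 ⟶ Y}
    {e : ((Ext R (ModuleCat.{u} R) 1).obj (op X')).obj Y} (h : IsClass P' f e)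
    (a : X ⟶ X') (φ : P.complex ⟶ P'.complex) (comm : φ.f 0 ≫ P'.π.f 0 = P.π.f 0 ≫ a) :
    IsClass P (φ.f 1 ≫ f) (((Ext R (ModuleCat.{u} R) 1).map a.op).app Y e) := by
  obtain ⟨k, rfl, rfl⟩ := h
  let F := ((linearYoneda R (ModuleCat.{u} R)).obj Y).rightOp
  refine ⟨(HomologicalComplex.opcyclesMap ((F.mapHomologicalComplex _).map φ) 1).unop k, ?_, ?_⟩
  · have h1 := P.isoLeftDerivedObj_hom_naturality a P' φ comm F 1
    have h2 := HomologicalComplex.homologyι_naturality ((F.mapHomologicalComplex _).map φ) 1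
    have h3 : (F.leftDerived 1).map a ≫ (P'.isoLeftDerivedObj F 1).hom ≫
        (homComplex P' Y).homologyι 1 = (P.isoLeftDerivedObj F 1).hom ≫
        (homComplex P Y).homologyι 1 ≫
          HomologicalComplex.opcyclesMap ((F.mapHomologicalComplex _).map φ) 1 := by
      exact (Category.assoc _ _ _).symm.trans (congr($h1 ≫ (homComplex P' Y).homologyι 1).trans
        ((Category.assoc _ _ _).trans congr((P.isoLeftDerivedObj F 1).hom ≫ $h2)))
    exact congr($(h3.symm).unop k)
  · exact congr($(HomologicalComplex.p_opcyclesMap ((F.mapHomologicalComplex _).map φ) 1).unop k)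


section Connecting

variable {B : ModuleCat.{u} R} {x : R} {p : Y ⟶ B}

lemma exists_eq_smul_of_comp_eq_zero (hx : IsSMulRegular Y x)
    (hp : ∀ y : Y, p y = 0 → ∃ z : Y, x • z = y) {A : ModuleCat.{u} R} (f : A ⟶ Y)
    (hf : f ≫ p = 0) : ∃ g : A ⟶ Y, f = x • g := by
  let m := LinearEquiv.ofInjective (LinearMap.lsmul R Y x) hx
  refine ⟨ModuleCat.ofHom (m.symm.toLinearMap ∘ₗ f.hom.codRestrict _ fun a => ?_), ?_⟩
  · obtain ⟨z, hz⟩ := hp (f a) congr($hf a)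
    exact ⟨z, hz⟩
  · ext a
    exact (congrArg Subtype.val (m.apply_symm_apply ⟨f a, _⟩)).symm

lemma smul_hom_injective (hx : IsSMulRegular Y x) {A : ModuleCat.{u} R} {f g : A ⟶ Y}
    (h : x • f = x • g) : f = g := by
  ext a
  exact hx congr($h a)

variable (x p) in
/-- `e` is the image of `ψ` under the connecting map `Hom(X, B) → Ext¹(X, Y)` of the sequence
`Y → Y → B` given by multiplication by `x` and `p`. -/
def IsConnecting (P : ProjectiveResolution X) (ψ : X ⟶ B)
    (e : ((Ext R (ModuleCat.{u} R) 1).obj (op X)).obj Y) : Prop :=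
  ∃ (f : P.complex.X 1 ⟶ Y) (g : P.complex.X 0 ⟶ Y), IsClass P f e ∧
    P.complex.d 1 0 ≫ g = x • f ∧ g ≫ p = P.π.f 0 ≫ ψ

lemma IsConnecting.add {P : ProjectiveResolution X} {ψ ψ' : X ⟶ B}
    {e e' : ((Ext R (ModuleCat.{u} R) 1).obj (op X)).obj Y} (h : IsConnecting x p P ψ e)
    (h' : IsConnecting x p P ψ' e') : IsConnecting x p P (ψ + ψ') (e + e') := by
  obtain ⟨f, g, h1, h2, h3⟩ := h
  obtain ⟨f', g', h1', h2', h3'⟩ := h'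
  refine ⟨f + f', g + g', h1.add h1', ?_, ?_⟩
  · rw [Preadditive.comp_add, h2, h2', smul_add]
  · rw [Preadditive.add_comp, h3, h3']
    exact (Preadditive.comp_add _ _ _ _ _ _).symm

lemma IsConnecting.smul {P : ProjectiveResolution X} {ψ : X ⟶ B}
    {e : ((Ext R (ModuleCat.{u} R) 1).obj (op X)).obj Y} (h : IsConnecting x p P ψ e) (r : R) :
    IsConnecting x p P (r • ψ) (r • e) := by
  obtain ⟨f, g, h1, h2, h3⟩ := h
  refine ⟨r • f, r • g, h1.smul r, ?_, ?_⟩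
  · rw [Linear.comp_smul, h2, smul_comm]
  · rw [Linear.smul_comp, h3]
    exact (Linear.comp_smul _ _ _ _ _ _).symm

lemma exists_isConnecting [Epi p] (hx : IsSMulRegular Y x)
    (hp : ∀ y : Y, p y = 0 → ∃ z : Y, x • z = y) (P : ProjectiveResolution X) (ψ : X ⟶ B) :
    ∃ e, IsConnecting x p P ψ e := by
  let q : P.complex.X 0 ⟶ B := P.π.f 0 ≫ ψ
  have hq : P.complex.d 1 0 ≫ q = 0 := by
    have := congr($(P.complex_d_comp_π_f_zero) ≫ ψ)
    exact (Category.assoc _ _ _).symm.trans (this.trans zero_comp)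
  obtain ⟨f, hf⟩ := exists_eq_smul_of_comp_eq_zero hx hp
    (P.complex.d 1 0 ≫ Projective.factorThru q p) (by simp [hq])
  obtain ⟨e, he⟩ := exists_isClass P f (smul_hom_injective hx (by
    rw [← Linear.comp_smul, ← hf]
    simp))
  exact ⟨e, f, Projective.factorThru q p, he, hf, Projective.factorThru_comp q p⟩

lemma IsConnecting.eq_zero (hx : IsSMulRegular Y x)
    (hp : ∀ y : Y, p y = 0 → ∃ z : Y, x • z = y) {P : ProjectiveResolution X}
    {e : ((Ext R (ModuleCat.{u} R) 1).obj (op X)).obj Y}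
    (h : IsConnecting x p P 0 e) : e = 0 := by
  obtain ⟨f, g, h1, h2, h3⟩ := h
  obtain ⟨g', rfl⟩ := exists_eq_smul_of_comp_eq_zero hx hp g (h3.trans comp_zero)
  exact h1.eq_zero_iff.2 ⟨g', smul_hom_injective hx (by rw [← h2, Linear.comp_smul])⟩

lemma exists_isConnecting_of_smul_eq_zero (hp : ∀ y : Y, p (x • y) = 0)
    (P : ProjectiveResolution X) (e : ((Ext R (ModuleCat.{u} R) 1).obj (op X)).obj Y)
    (h : x • e = 0) : ∃ ψ, IsConnecting x p P ψ e := by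
  obtain ⟨f, hf⟩ := exists_isClass_of_ext P e
  obtain ⟨g, hg⟩ := (hf.smul x).eq_zero_iff.1 h
  have hgp : P.complex.d 1 0 ≫ g ≫ p = 0 := by
    rw [reassoc_of% hg]
    ext a
    exact hp (f a)
  exact ⟨P.isColimitCokernelCofork.desc (CokernelCofork.ofπ _ hgp), f, g, hf, hg,
    (P.isColimitCokernelCofork.fac (CokernelCofork.ofπ _ hgp) WalkingParallelPair.one).symm⟩

lemma IsConnecting.map {P : ProjectiveResolution X} {P' : ProjectiveResolution X'} {ψ : X' ⟶ B}
    {e : ((Ext R (ModuleCat.{u} R) 1).obj (op X')).obj Y} (h : IsConnecting x p P' ψ e)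
    (a : X ⟶ X') :
    IsConnecting x p P (a ≫ ψ) (((Ext R (ModuleCat.{u} R) 1).map a.op).app Y e) := by
  obtain ⟨f, g, h1, h2, h3⟩ := h
  let φ := ProjectiveResolution.lift a P P'
  have comm : φ.f 0 ≫ P'.π.f 0 = P.π.f 0 ≫ a := ProjectiveResolution.lift_commutes_zero a P P'
  refine ⟨φ.f 1 ≫ f, φ.f 0 ≫ g, h1.map a φ comm, ?_, ?_⟩
  · rw [← φ.comm_assoc, h2, Linear.comp_smul]
  · rw [Category.assoc, h3]
    exact (Category.assoc _ _ _).symm.trans (congr($comm ≫ ψ).trans (Category.assoc _ _ _))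

variable (X) in
/-- The relation `IsConnecting` is the graph of a linear map `Hom(X, B) → Ext¹(X, Y)`, for the
sequence `0 → Y → Y → B → 0` given by
multiplication by `x` and `p`. -/
lemma exists_connectingMap [Epi p] (hx : IsSMulRegular Y x)
    (hp : ∀ y : Y, p y = 0 → ∃ z : Y, x • z = y) (P : ProjectiveResolution X) :
    ∃ δ : (X ⟶ B) →ₗ[R] ((Ext R (ModuleCat.{u} R) 1).obj (op X)).obj Y,
      ∀ ψ e, IsConnecting x p P ψ e ↔ e = δ ψ := by
  choose δ hδ using exists_isConnecting (X := X) hx hp P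
  have huniq : ∀ ψ e, IsConnecting x p P ψ e → e = δ ψ := fun ψ e h => by
    have := h.add ((hδ ψ).smul (-1))
    rw [neg_one_smul, neg_one_smul, add_neg_cancel, ← sub_eq_add_neg] at this
    exact sub_eq_zero.1 (this.eq_zero hx hp)
  exact ⟨{ toFun := δ
           map_add' := fun a b => (huniq _ _ ((hδ a).add (hδ b))).symm
           map_smul' := fun r a => (huniq _ _ ((hδ a).smul r)).symm },
    fun ψ e => ⟨huniq ψ e, fun h => h ▸ hδ ψ⟩⟩

end Connecting

end ExtOne

namespace localCohomology

open Opposite Limits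

variable {R : Type u} [CommRing R]

lemma exists_factor_of_torsionBySet_le {I J : Ideal R} (hIJ : I ≤ J) {B : Type u}
    [AddCommGroup B] [Module R B]
    (h : Submodule.torsionBySet R B (I : Set R) ≤ Submodule.torsionBySet R B (J : Set R))
    (ψ : (R ⧸ I) →ₗ[R] B) :
    ∃ ψ' : (R ⧸ J) →ₗ[R] B, ψ = ψ' ∘ₗ Submodule.mapQ I J LinearMap.id hIJ := by
  have hψ : ψ (Submodule.Quotient.mk 1) ∈ Submodule.torsionBySet R B (J : Set R) := by
    refine h ((Submodule.mem_torsionBySet_iff _ _).2 fun a => ?_)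
    rw [← map_smul, ← Submodule.Quotient.mk_smul, smul_eq_mul, mul_one,
      (Submodule.Quotient.mk_eq_zero I).2 a.2, map_zero]
  refine ⟨Submodule.liftQ J (LinearMap.toSpanSingleton R B (ψ (Submodule.Quotient.mk 1)))
    fun a ha => (Submodule.mem_torsionBySet_iff _ _).1 hψ ⟨a, ha⟩, ?_⟩
  ext
  exact (one_smul R _).symm

/-- If `H¹_J(Y)` is killed by a nonzerodivisor on the finite module `Y`, then it is finite. -/
theorem finite_one_of_mem_annihilator [IsNoetherianRing R] (J : Ideal R) (Y : ModuleCat.{u} R)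
    [Module.Finite R Y] {x : R} (hx : IsSMulRegular Y x)
    (hann : x ∈ Module.annihilator R ((localCohomology J 1).obj Y)) :
    Module.Finite R ((localCohomology J 1).obj Y) := by
  let N : Submodule R Y := LinearMap.range (LinearMap.lsmul R Y x)
  let B : ModuleCat.{u} R := ModuleCat.of R (Y ⧸ N)
  let p : Y ⟶ B := ModuleCat.ofHom N.mkQ
  have : Epi p := (ModuleCat.epi_iff_surjective p).2 N.mkQ_surjective
  have hp : ∀ y : Y, p y = 0 → ∃ z : Y, x • z = y := fun y h =>
    (Submodule.Quotient.mk_eq_zero N).1 h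
  have hp' : ∀ y : Y, p (x • y) = 0 := fun y => (Submodule.Quotient.mk_eq_zero N).2 ⟨y, rfl⟩
  let X (i : ℕᵒᵖᵒᵖ) : ModuleCat.{u} R := (ringModIdeals (idealPowersDiagram J)).obj i.unop
  choose δ hδ using fun i => ExtOne.exists_connectingMap (X i) hx hp (projectiveResolution (X i))
  let G := diagram (idealPowersDiagram J) 1 ⋙ (evaluation _ _).obj Y
  have hcol := isColimitOfPreserves ((evaluation _ (ModuleCat.{u} R)).obj Y)
    (colimit.isColimit (diagram (idealPowersDiagram J) 1))
  let c : Cocone G :=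
    ((evaluation _ (ModuleCat.{u} R)).obj Y).mapCocone
      (colimit.cocone (diagram (idealPowersDiagram J) 1))
  replace hcol : IsColimit c := hcol
  obtain ⟨n, hn⟩ := monotone_stabilizes_iff_noetherian.2 (inferInstanceAs (IsNoetherian R B))
    ⟨fun n => Submodule.torsionBySet R B (J ^ n : Ideal R), fun a b hab =>
      Submodule.torsionBySet_le_torsionBySet_of_subset (Ideal.pow_le_pow_right hab)⟩
  let l : ℕᵒᵖᵒᵖ := op (op n)
  have : IsNoetherian R (X l →ₗ[R] B) :=
    inferInstanceAs (IsNoetherian R ((R ⧸ J ^ n) →ₗ[R] (Y ⧸ N)))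
  have : Module.Finite R (X l ⟶ B) :=
    Module.Finite.equiv (ModuleCat.homLinearEquiv (S := R) (M := X l) (N := B)).symm
  have : PreservesFilteredColimitsOfSize.{0, 0} (forget (ModuleCat.{u} R)) :=
    preservesFilteredColimitsOfSize_shrink.{0, u, 0, u} _
  have := PreservesFilteredColimitsOfSize.preserves_filtered_colimits
    (F := forget (ModuleCat.{u} R)) ℕᵒᵖᵒᵖ
  suffices h : Function.Surjective ((c.ι.app l).hom ∘ₗ δ l) from
    Module.Finite.of_surjective _ h
  intro h
  obtain ⟨i, e, rfl⟩ := Concrete.isColimit_exists_rep G hcol h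
  have h0 : c.ι.app i (x • e) = c.ι.app i 0 := by
    rw [map_smul, map_zero]
    exact Module.mem_annihilator.1 hann _
  obtain ⟨j, f, g, hfg⟩ := (Concrete.isColimit_rep_eq_iff_exists G hcol _ _).1 h0
  let k : ℕᵒᵖᵒᵖ := op (op (max j.unop.unop n))
  let u : j ⟶ k := (homOfLE (le_max_left _ _)).op.op
  let v : l ⟶ k := (homOfLE (le_max_right _ _)).op.op
  have hk : x • G.map (f ≫ u) e = 0 := by
    rw [← map_smul, G.map_comp]
    exact (congrArg (G.map u) (hfg.trans (map_zero _))).trans (map_zero _)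
  obtain ⟨ψ, hψ⟩ :=
    ExtOne.exists_isConnecting_of_smul_eq_zero hp' (projectiveResolution (X k)) _ hk
  obtain ⟨ψ', hψ'⟩ := exists_factor_of_torsionBySet_le
    (Ideal.pow_le_pow_right (I := J) (le_max_right j.unop.unop n)) (hn _ (le_max_right _ _)).ge ψ.hom
  have hmap := ((hδ l (ModuleCat.ofHom ψ') _).2 rfl).map (P := projectiveResolution (X k))
    ((ringModIdeals (idealPowersDiagram J)).map v.unop)
  have hψeq : ψ = (ringModIdeals (idealPowersDiagram J)).map v.unop ≫ ModuleCat.ofHom ψ' :=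
    ModuleCat.hom_ext hψ'
  have key : G.map (f ≫ u) e = G.map v (δ l (ModuleCat.ofHom ψ')) := by
    rw [(hδ k _ _).1 hψ, hψeq]
    exact ((hδ k _ _).1 hmap).symm
  refine ⟨ModuleCat.ofHom ψ', ?_⟩
  calc c.ι.app l (δ l (ModuleCat.ofHom ψ'))
      = c.ι.app k (G.map v (δ l (ModuleCat.ofHom ψ'))) := congr($((c.w v).symm) _)
    _ = c.ι.app k (G.map (f ≫ u) e) := by rw [key]
    _ = c.ι.app i e := congr($(c.w (f ≫ u)) e)

end localCohomology

/-- If `(R, 𝔪)` is a Noetherian local domain of dimension at least `1` such that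
`H^1_𝔪(R)` is not finitely generated, then `H^1_𝔪(R)` is a faithful `R`-module. -/
theorem annihilator_localCohomology_eq_bot (R : Type) [CommRing R] [IsDomain R]
    [IsNoetherianRing R] [IsLocalRing R] (hdim : 1 ≤ ringKrullDim R)
    (hfg : ¬ Module.Finite R
      ((localCohomology (IsLocalRing.maximalIdeal R) 1).obj (ModuleCat.of R R))) :
    Module.annihilator R
      ((localCohomology (IsLocalRing.maximalIdeal R) 1).obj (ModuleCat.of R R)) = ⊥ := by
  refine (Submodule.eq_bot_iff _).2 fun x hx => by_contra fun hx0 => hfg ?_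
  exact localCohomology.finite_one_of_mem_annihilator _ _
    (fun a b h => mul_left_cancel₀ hx0 h) hx
end
end

section
/- Let $(R,\mathfrak{m})$ be a commutative Noetherian local domain of Krull dimension at least $1$, and let $x$ be a nonzero element of $\mathfrak{m}$. Then the $R$-module $H^1_{\mathfrak{m}}(R)$ is $Rx$-cofinite. -/
open CategoryTheory

noncomputable section

/-- `Ext` over a ring is presented by the cocycles of a projective resolution modulo
coboundaries. -/
theorem exists_ext_presentation {R : Type} [CommRing R] {X : ModuleCat.{0} R}
    (P : ProjectiveResolution X) (Y : ModuleCat.{0} R) (n : ℕ) :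
    ∃ q : LinearMap.ker (LinearMap.lcomp R Y (P.complex.d (n + 1) n).hom) →ₗ[R]
        ((Ext R (ModuleCat.{0} R) n).obj (Opposite.op X)).obj Y,
      Function.Surjective q ∧
      ∀ z, q z = 0 ↔ ∃ ψ : P.complex.X (n - 1) →ₗ[R] Y,
        ψ ∘ₗ (P.complex.d n (n - 1)).hom = z := by
  let K := P.complex.linearYonedaObj R Y
  have hprev : (ComplexShape.up ℕ).prev n = n - 1 := by
    cases n
    · exact CochainComplex.prev_nat_zero
    · exact CochainComplex.prev_nat_succ _
  let S := K.sc' (n - 1) n (n + 1)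
  let e := ((P.isoExt (R := R) n Y) ≪≫ K.homologyIsoSc' (n - 1) n (n + 1) hprev (by simp)
    ≪≫ S.moduleCatHomologyIso).toLinearEquiv
  let h : (P.complex.X n ⟶ Y) ≃ₗ[R] (P.complex.X n →ₗ[R] Y) := ModuleCat.homLinearEquiv
  let c : LinearMap.ker (LinearMap.lcomp R Y (P.complex.d (n + 1) n).hom) →ₗ[R]
      LinearMap.ker S.g.hom :=
    (h.symm.toLinearMap ∘ₗ Submodule.subtype _).codRestrict _ (by
      rintro ⟨z, hz⟩
      exact ModuleCat.hom_ext hz)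
  refine ⟨e.symm.toLinearMap ∘ₗ (LinearMap.range S.moduleCatToCycles).mkQ ∘ₗ c, ?_, ?_⟩
  · refine e.symm.surjective.comp ((Submodule.mkQ_surjective _).comp ?_)
    rintro ⟨z, hz⟩
    refine ⟨⟨h z, ?_⟩, ?_⟩
    · exact congrArg ModuleCat.Hom.hom hz
    · exact Subtype.ext (h.symm_apply_apply z)
  · intro z
    have h1 : (e.symm.toLinearMap ∘ₗ (LinearMap.range S.moduleCatToCycles).mkQ ∘ₗ c) z = 0 ↔
        c z ∈ LinearMap.range S.moduleCatToCycles := by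
      rw [← Submodule.Quotient.mk_eq_zero]
      exact e.symm.map_eq_zero_iff
    rw [h1]
    constructor
    · rintro ⟨ψ, hψ⟩
      exact ⟨ModuleCat.Hom.hom ψ, congrArg ModuleCat.Hom.hom (congrArg Subtype.val hψ)⟩
    · rintro ⟨ψ, hψ⟩
      exact ⟨ModuleCat.ofHom ψ, Subtype.ext (ModuleCat.hom_ext hψ)⟩

/-- If `x` acts locally nilpotently on `M` and the kernel of `x` has finite length, then `M / xM` is
finitely generated. -/
theorem finite_quotient_range_lsmul {R M : Type*} [CommRing R] [AddCommGroup M] [Module R M]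
    (x : R) (htors : ∀ m : M, ∃ n : ℕ, x ^ n • m = 0)
    [IsNoetherian R (Submodule.torsionBy R M x)] [IsArtinian R (Submodule.torsionBy R M x)] :
    Module.Finite R (M ⧸ LinearMap.range (LinearMap.lsmul R M x)) := by
  let T := Submodule.torsionBy R M x
  let D (n : ℕ) : Submodule R M := LinearMap.range (LinearMap.lsmul R M (x ^ n))
  have hD : Antitone D := by
    refine antitone_nat_of_succ_le fun n ↦ ?_
    rintro _ ⟨m, rfl⟩
    exact ⟨x • m, by simp [pow_succ, mul_smul, smul_comm x]⟩
  obtain ⟨N, hN⟩ := IsArtinian.monotone_stabilizes (R := R) (M := T)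
    ⟨fun n ↦ OrderDual.toDual ((D n).comap T.subtype), fun a b hab ↦
      Submodule.comap_mono (hD hab)⟩
  have hN' (n : ℕ) (hn : N ≤ n) (t : M) (ht : x • t = 0) (h : t ∈ D N) : t ∈ D n := by
    have h1 : (D N).comap T.subtype = (D n).comap T.subtype := hN n hn
    have h2 : (⟨t, by simpa [T] using ht⟩ : T) ∈ (D N).comap T.subtype := h
    rw [h1] at h2
    exact h2
  have hstab (k : ℕ) : ∀ m ∈ D N, x ^ k • m = 0 → m ∈ D (N + 1) := by
    induction k with
    | zero => intro m _ h; simp at h; simp [h]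
    | succ k ih =>
      intro m hm h
      have h1 : x ^ k • m ∈ D N := Submodule.smul_mem _ _ hm
      obtain ⟨m', hm'⟩ := hN' (N + k + 1) (by lia) _ (by rwa [smul_smul, ← pow_succ']) h1
      have h2 : x ^ (N + 1) • m' ∈ D (N + 1) := ⟨m', rfl⟩
      have h3 := ih (m - x ^ (N + 1) • m') (sub_mem hm (hD (Nat.le_succ N) h2)) (by
        rw [smul_sub, ← hm', smul_smul, ← pow_add]
        simp only [LinearMap.lsmul_apply]
        rw [sub_eq_zero]; congr 2; lia)
      simpa using add_mem h3 h2
  have hDN (k : ℕ) : D N ≤ D (N + k) := by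
    induction k with
    | zero => exact le_rfl
    | succ k ih =>
      intro m hm
      obtain ⟨m', rfl⟩ := ih hm
      obtain ⟨j, hj⟩ := htors (x ^ N • m')
      obtain ⟨m'', h''⟩ := hstab j (x ^ N • m') ⟨m', rfl⟩ hj
      refine ⟨m'', ?_⟩
      simp only [LinearMap.lsmul_apply] at h'' ⊢
      rw [show N + (k + 1) = k + (N + 1) by lia, pow_add, mul_smul, h'', smul_smul, ← pow_add,
        add_comm k N]
  have hker (n : ℕ) : IsNoetherian R (Submodule.torsionBy R M (x ^ n)) := by
    induction n with
    | zero =>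
      have : Subsingleton (Submodule.torsionBy R M (x ^ 0)) := by simp; infer_instance
      infer_instance
    | succ n ih =>
      let f : Submodule.torsionBy R M (x ^ (n + 1)) →ₗ[R] Submodule.torsionBy R M (x ^ n) :=
        (LinearMap.lsmul R M x).restrict fun m hm ↦ by
          simpa [smul_smul, ← pow_succ] using hm
      have : IsNoetherian R (LinearMap.ker f) := by
        refine isNoetherian_of_injective ((Submodule.subtype _ ∘ₗ Submodule.subtype _).codRestrict T
          fun m ↦ ?_) ?_
        · exact (Submodule.mem_torsionBy_iff _ _).2 (congrArg Subtype.val (LinearMap.mem_ker.1 m.2))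
        · intro a b hab
          exact Subtype.ext (Subtype.ext (congrArg (fun t : T ↦ (t : M)) hab))
      exact isNoetherian_of_range_eq_ker (LinearMap.ker f).subtype f (by simp)
  have := hker N
  refine Module.Finite.of_surjective
    ((Submodule.mkQ _) ∘ₗ (Submodule.torsionBy R M (x ^ N)).subtype) fun m ↦ ?_
  obtain ⟨m, rfl⟩ := Submodule.mkQ_surjective _ m
  obtain ⟨m', hm'⟩ := hDN (N + 1) ⟨m, rfl⟩
  simp only [LinearMap.lsmul_apply] at hm'
  refine ⟨⟨m - x ^ (N + 1) • m', ?_⟩, ?_⟩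
  · rw [Submodule.mem_torsionBy_iff, smul_sub, smul_smul, ← pow_add, hm', sub_self]
  · refine (Submodule.Quotient.eq _).2 ⟨- x ^ N • m', ?_⟩
    simp [pow_succ', mul_smul]

/-- A finitely generated module over a Noetherian local ring that is torsion with respect to the
maximal ideal is Artinian. -/
theorem isArtinian_of_forall_maximalIdeal_pow_smul_eq_zero {R M : Type*} [CommRing R]
    [IsNoetherianRing R] [IsLocalRing R] [AddCommGroup M] [Module R M] [Module.Finite R M]
    (h : ∀ m : M, ∃ n : ℕ, ∀ r ∈ IsLocalRing.maximalIdeal R ^ n, r • m = 0) :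
    IsArtinian R M := by
  obtain ⟨s, hs⟩ := Module.Finite.fg_top (R := R) (M := M)
  choose n hn using h
  let N := s.sup n + 1
  let I := IsLocalRing.maximalIdeal R ^ N
  have hI : I ≤ IsLocalRing.maximalIdeal R := Ideal.pow_le_self (by simp [N])
  have hM (r : R) (hr : r ∈ I) (m : M) : r • m = 0 := by
    have hm : m ∈ Submodule.span R (s : Set M) := hs ▸ Submodule.mem_top
    induction hm using Submodule.span_induction with
    | mem m hm =>
      exact hn m r (Ideal.pow_le_pow_right ((Finset.le_sup hm).trans (Nat.le_succ _)) hr)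
    | zero => simp
    | add a b _ _ ha hb => simp [ha, hb]
    | smul a b _ hb => rw [smul_comm, hb, smul_zero]
  have : Nontrivial (R ⧸ I) := Ideal.Quotient.nontrivial_iff.2
    (ne_top_of_le_ne_top (IsLocalRing.maximalIdeal.isMaximal R).ne_top hI)
  have : IsLocalRing (R ⧸ I) := .of_surjective' _ Ideal.Quotient.mk_surjective
  have : IsArtinianRing (R ⧸ I) := by
    rw [isArtinianRing_iff_isNilpotent_maximalIdeal]
    refine ⟨N, ?_⟩
    have h1 : IsLocalRing.maximalIdeal (R ⧸ I) =
        (IsLocalRing.maximalIdeal R).map (Ideal.Quotient.mk I) := by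
      refine (IsLocalRing.eq_maximalIdeal ?_).symm
      refine (Ideal.map_eq_top_or_isMaximal_of_surjective _ Ideal.Quotient.mk_surjective
        inferInstance).resolve_left fun h ↦ ?_
      have := congrArg (Ideal.comap (Ideal.Quotient.mk I)) h
      rw [Ideal.comap_map_of_surjective _ Ideal.Quotient.mk_surjective, Ideal.comap_top,
        ← RingHom.ker_eq_comap_bot, Ideal.mk_ker, sup_eq_left.2 hI] at this
      exact (IsLocalRing.maximalIdeal.isMaximal R).ne_top this
    rw [h1, ← Ideal.map_pow]
    exact Ideal.map_quotient_self I
  have hT : Module.IsTorsionBySet R M (I : Set R) := fun m r ↦ hM r r.2 m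
  let : Module (R ⧸ I) M := hT.module
  have : IsScalarTower R (R ⧸ I) M := hT.isScalarTower
  have : Module.Finite (R ⧸ I) M := Module.Finite.of_restrictScalars_finite R _ _
  exact isArtinian_of_surjective_algebraMap (R := R ⧸ I) Ideal.Quotient.mk_surjective

/-- An increasing union of submodules whose lengths are bounded by that of a module of finite length
has finite length. -/
theorem isFiniteLength_of_monotone_iUnion {R M : Type*} [Ring R] [AddCommGroup M] [Module R M]
    (E : ℕ → Submodule R M) (hE : Monotone E) (hcov : ∀ m, ∃ n, m ∈ E n)
    {L : ℕ∞} (hL : L ≠ ⊤) (hlen : ∀ n, Module.length R (E n) ≤ L) : IsFiniteLength R M := by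
  have hne (n : ℕ) : Module.length R (E n) ≠ ⊤ := ne_top_of_le_ne_top hL (hlen n)
  obtain ⟨N, hN⟩ : ∃ N, ∀ n, Module.length R (E n) ≤ Module.length R (E N) := by
    lift L to ℕ using hL
    choose l hl using fun n ↦ ENat.ne_top_iff_exists.1 (hne n)
    simp only [← hl, Nat.cast_le] at hlen ⊢
    obtain ⟨_, ⟨⟨N, rfl⟩, hN⟩⟩ := ((Set.finite_Iic L).subset
      (Set.range_subset_iff.2 hlen)).exists_maximal (Set.range_nonempty l)
    exact ⟨N, fun n ↦ (le_total (l n) (l N)).elim id (hN ⟨n, rfl⟩)⟩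
  have htop : E N = ⊤ := by
    refine eq_top_iff.2 fun m _ ↦ ?_
    obtain ⟨n, hn⟩ := hcov m
    by_contra hm
    have hlt : E N < E (max n N) :=
      lt_of_le_of_ne (hE (le_max_right _ _)) fun h ↦ hm (h ▸ hE (le_max_left _ _) hn)
    have h1 := Order.height_strictMono hlt
      (by rw [← Module.length_submodule]; exact (hne _).lt_top)
    rw [← Module.length_submodule, ← Module.length_submodule] at h1
    exact absurd (hN (max n N)) (not_le.2 h1)
  have h1 := hne N
  rw [htop, Module.length_top] at h1
  exact Module.length_ne_top_iff.1 h1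

/-- If `d₁ : P₁ → P₀` presents a module annihilated by `r` and `P₀` is projective, then
multiplication by `r` on `P₀` factors through `d₁`. -/
theorem exists_comp_eq_smul_id {R P₀ P₁ Q : Type*} [CommRing R] [AddCommGroup P₀] [AddCommGroup P₁]
    [AddCommGroup Q] [Module R P₀] [Module R P₁] [Module R Q] [Module.Projective R P₀]
    {d₁ : P₁ →ₗ[R] P₀} {p : P₀ →ₗ[R] Q} (h₁ : Function.Exact d₁ p) {r : R}
    (hr : ∀ z : Q, r • z = 0) : ∃ h : P₀ →ₗ[R] P₁, d₁ ∘ₗ h = r • LinearMap.id := by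
  obtain ⟨h, hh⟩ := Module.projective_lifting_property d₁.rangeRestrict
    ((r • LinearMap.id : P₀ →ₗ[R] P₀).codRestrict (LinearMap.range d₁) fun v ↦
      (h₁ _).1 (by simp [hr]))
    d₁.surjective_rangeRestrict
  refine ⟨h, LinearMap.ext fun v ↦ ?_⟩
  exact congrArg (LinearMap.range d₁).subtype (LinearMap.congr_fun hh v)

/-- A null-homotopy of multiplication by `r` in degree `0` shows that `r` annihilates the class of
any `1`-cocycle. -/
theorem cocycle_comp_comp_eq_smul {R P₀ P₁ P₂ Y : Type*} [CommRing R] [AddCommGroup P₀]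
    [AddCommGroup P₁] [AddCommGroup P₂] [AddCommGroup Y] [Module R P₀] [Module R P₁] [Module R P₂]
    [Module R Y] {d₁ : P₁ →ₗ[R] P₀} {d₂ : P₂ →ₗ[R] P₁} (h₂ : Function.Exact d₂ d₁)
    {r : R} {h : P₀ →ₗ[R] P₁} (hh : d₁ ∘ₗ h = r • LinearMap.id)
    {φ : P₁ →ₗ[R] Y} (hφ : φ ∘ₗ d₂ = 0) : (φ ∘ₗ h) ∘ₗ d₁ = r • φ := by
  refine LinearMap.ext fun v ↦ ?_
  obtain ⟨w, hw⟩ := (h₂ (h (d₁ v) - r • v)).1 (by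
    have := LinearMap.congr_fun hh (d₁ v)
    simp only [LinearMap.comp_apply, LinearMap.smul_apply, LinearMap.id_apply] at this
    rw [map_sub, this, map_smul, sub_self])
  have h3 := LinearMap.congr_fun hφ w
  simp only [LinearMap.comp_apply, hw, map_sub, map_smul, LinearMap.zero_apply, sub_eq_zero] at h3
  simpa using h3

/-- If `R` is a domain with fraction field `K` and `J` is a nonzero ideal, then degree one
cocycles on a projective resolution of `R / J` map to `K / R` with kernel the coboundaries. -/
theorem exists_cocycle_to_fractionRing_quotient {R P₀ P₁ P₂ : Type*} [CommRing R] [IsDomain R]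
    [AddCommGroup P₀] [AddCommGroup P₁] [AddCommGroup P₂] [Module R P₀] [Module R P₁] [Module R P₂]
    [Module.Projective R P₀] {J : Ideal R} {y : R} (hyJ : y ∈ J) (hy : y ≠ 0)
    {p : P₀ →ₗ[R] R ⧸ J} {d₁ : P₁ →ₗ[R] P₀} {d₂ : P₂ →ₗ[R] P₁} (hp : Function.Surjective p)
    (h₁ : Function.Exact d₁ p) (h₂ : Function.Exact d₂ d₁) :
    ∃ θ : LinearMap.ker (LinearMap.lcomp R R d₂) →ₗ[R]
        FractionRing R ⧸ LinearMap.range (Algebra.linearMap R (FractionRing R)),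
      ∀ z, θ z = 0 ↔ ∃ ψ : P₀ →ₗ[R] R, ψ ∘ₗ d₁ = z := by
  obtain ⟨h, hh⟩ := exists_comp_eq_smul_id h₁ (r := y) (by
    intro z
    obtain ⟨z, rfl⟩ := Ideal.Quotient.mk_surjective z
    rw [Algebra.smul_def]
    change Ideal.Quotient.mk J y * _ = 0
    rw [Ideal.Quotient.eq_zero_iff_mem.2 hyJ, zero_mul])
  have hdh (v : P₀) : d₁ (h v) = y • v := LinearMap.congr_fun hh v
  obtain ⟨e, he⟩ := hp 1
  let K := FractionRing R
  have hyK : algebraMap R K y ≠ 0 := by simpa using hy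
  let θ : LinearMap.ker (LinearMap.lcomp R R d₂) →ₗ[R]
      K ⧸ LinearMap.range (Algebra.linearMap R K) :=
    Submodule.mkQ _ ∘ₗ LinearMap.mulLeft R (algebraMap R K y)⁻¹ ∘ₗ Algebra.linearMap R K ∘ₗ
      LinearMap.applyₗ (h e) ∘ₗ Submodule.subtype _
  have hθ (z) : θ z = 0 ↔ ∃ c, z.1 (h e) = y * c := by
    change Submodule.Quotient.mk ((algebraMap R K y)⁻¹ * algebraMap R K (z.1 (h e))) = _ ↔ _
    rw [Submodule.Quotient.mk_eq_zero]
    refine exists_congr fun c ↦ ?_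
    rw [Algebra.linearMap_apply, eq_inv_mul_iff_mul_eq₀ hyK, ← map_mul,
      (FaithfulSMul.algebraMap_injective R K).eq_iff, eq_comm]
  refine ⟨θ, fun z ↦ (hθ z).trans ⟨?_, ?_⟩⟩
  · rintro ⟨c, hc⟩
    have hz : (z.1 ∘ₗ h) ∘ₗ d₁ = y • z.1 :=
      cocycle_comp_comp_eq_smul h₂ hh (LinearMap.mem_ker.1 z.2)
    have hdvd (v : P₀) : (z.1 ∘ₗ h) v ∈ LinearMap.range (LinearMap.lsmul R R y) := by
      obtain ⟨a, ha⟩ := Ideal.Quotient.mk_surjective (p v)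
      obtain ⟨u, hu⟩ := (h₁ (v - a • e)).1 (by
        rw [map_sub, map_smul, he, ← ha, Algebra.smul_def, mul_one]
        exact sub_self _)
      refine ⟨a * c + z.1 u, ?_⟩
      have h3 := LinearMap.congr_fun hz u
      simp only [LinearMap.comp_apply, hu, map_sub, map_smul, hc, LinearMap.smul_apply,
        smul_eq_mul, sub_eq_iff_eq_add] at h3
      simp only [LinearMap.comp_apply, h3, LinearMap.lsmul_apply, smul_eq_mul]
      ring
    let m := LinearEquiv.ofInjective (LinearMap.lsmul R R y) (LinearMap.lsmul_injective hy)
    have hm (v) : y * (m.symm v) = v := congrArg Subtype.val (m.apply_symm_apply v)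
    refine ⟨m.symm.toLinearMap ∘ₗ (z.1 ∘ₗ h).codRestrict _ hdvd, LinearMap.ext fun v ↦ ?_⟩
    refine mul_left_cancel₀ hy ?_
    refine (hm _).trans ?_
    exact LinearMap.congr_fun hz v
  · rintro ⟨ψ, hψ⟩
    refine ⟨ψ e, ?_⟩
    rw [← hψ, LinearMap.comp_apply, hdh, map_smul, smul_eq_mul]

/-- A linear map factors through a surjection with the same kernel as an injective map. -/
theorem LinearMap.exists_injective_of_ker_eq_ker {R A B C : Type*} [Ring R] [AddCommGroup A]
    [AddCommGroup B] [AddCommGroup C] [Module R A] [Module R B] [Module R C] (q : A →ₗ[R] B)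
    (hq : Function.Surjective q) (f : A →ₗ[R] C) (h : LinearMap.ker q = LinearMap.ker f) :
    ∃ g : B →ₗ[R] C, Function.Injective g := by
  refine ⟨(LinearMap.ker q).liftQ f h.le ∘ₗ (q.quotKerEquivOfSurjective hq).symm.toLinearMap, ?_⟩
  refine Function.Injective.comp (g := (LinearMap.ker q).liftQ f h.le) ?_
    (q.quotKerEquivOfSurjective hq).symm.injective
  exact LinearMap.ker_eq_bot.1 (Submodule.ker_liftQ_eq_bot _ _ _ h.ge)

/-- The elements of `K / R` that are killed by `x` and by a power of the maximal ideal form a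
finitely generated submodule. -/
theorem exists_finite_submodule_fractionRing_quotient (R : Type*) [CommRing R] [IsDomain R]
    [IsNoetherianRing R] [IsLocalRing R] {x : R} (hx : x ≠ 0) :
    ∃ T : Submodule R (FractionRing R ⧸ LinearMap.range (Algebra.linearMap R (FractionRing R))),
      Module.Finite R T ∧ ∀ t, t ∈ T ↔
        x • t = 0 ∧ ∃ n : ℕ, ∀ r ∈ IsLocalRing.maximalIdeal R ^ n, r • t = 0 := by
  let K := FractionRing R
  let T : Submodule R (K ⧸ LinearMap.range (Algebra.linearMap R K)) :=
    { carrier := {t | x • t = 0 ∧ ∃ n : ℕ, ∀ r ∈ IsLocalRing.maximalIdeal R ^ n, r • t = 0}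
      zero_mem' := by simp
      add_mem' := by
        rintro a b ⟨ha, n, hn⟩ ⟨hb, k, hk⟩
        refine ⟨by rw [smul_add, ha, hb, add_zero], max n k, fun r hr ↦ ?_⟩
        rw [smul_add, hn r (Ideal.pow_le_pow_right (le_max_left _ _) hr),
          hk r (Ideal.pow_le_pow_right (le_max_right _ _) hr), add_zero]
      smul_mem' := by
        rintro c a ⟨ha, n, hn⟩
        exact ⟨by rw [smul_comm, ha, smul_zero], n, fun r hr ↦ by
          rw [smul_comm, hn r hr, smul_zero]⟩ }
  refine ⟨T, ?_, fun t ↦ Iff.rfl⟩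
  have hxK : algebraMap R K x ≠ 0 := by simpa using hx
  have hT : T ≤ Submodule.span R {Submodule.Quotient.mk (algebraMap R K x)⁻¹} := by
    rintro t ⟨ht, -⟩
    obtain ⟨k, rfl⟩ := Submodule.mkQ_surjective _ t
    rw [← map_smul, Submodule.mkQ_apply, Submodule.Quotient.mk_eq_zero] at ht
    obtain ⟨c, hc⟩ := ht
    refine Submodule.mem_span_singleton.2 ⟨c, ?_⟩
    rw [← Submodule.Quotient.mk_smul, Submodule.mkQ_apply]
    congr 1
    rw [Algebra.linearMap_apply, Algebra.smul_def] at hc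
    rw [Algebra.smul_def, hc]
    exact (mul_right_comm _ _ _).trans (by rw [mul_inv_cancel₀ hxK, one_mul])
  have := isNoetherian_of_le hT
  exact Module.IsNoetherian.finite R T

/-- The augmentation of a projective resolution, as a linear map. -/
theorem CategoryTheory.ProjectiveResolution.exists_exact_linearMap {R : Type} [CommRing R]
    {M : Type} [AddCommGroup M] [Module R M] (P : ProjectiveResolution (ModuleCat.of R M)) :
    ∃ p : P.complex.X 0 →ₗ[R] M, Function.Surjective p ∧
      Function.Exact (P.complex.d 1 0).hom p := by
  refine ⟨(P.π.f 0).hom, (ModuleCat.epi_iff_surjective _).1 inferInstance, ?_⟩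
  have h := ShortComplex.exact_of_g_is_cokernel
    (ShortComplex.mk (P.complex.d 1 0) (P.π.f 0) P.complex_d_comp_π_f_zero)
    P.isColimitCokernelCofork
  exact (ShortComplex.ShortExact.moduleCat_exact_iff_function_exact _).1 h

instance {R : Type} [CommRing R] {X : ModuleCat.{0} R} (P : ProjectiveResolution X) (n : ℕ) :
    Module.Projective R (P.complex.X n) :=
  (IsProjective.iff_projective _).2 (P.projective n)

theorem CategoryTheory.ProjectiveResolution.function_exact {R : Type} [CommRing R]
    {X : ModuleCat.{0} R} (P : ProjectiveResolution X) (n : ℕ) :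
    Function.Exact (P.complex.d (n + 2) (n + 1)).hom (P.complex.d (n + 1) n).hom :=
  (ShortComplex.ShortExact.moduleCat_exact_iff_function_exact _).1 (P.exact_succ n)

/-- An ideal `J` annihilates `Ext¹(R / J, Y)`. -/
theorem smul_ext_one_quotient_eq_zero {R : Type} [CommRing R] {J : Ideal R} {Y : ModuleCat.{0} R}
    {r : R} (hr : r ∈ J)
    (u : ((Ext R (ModuleCat.{0} R) 1).obj (Opposite.op (ModuleCat.of R (R ⧸ J)))).obj Y) :
    r • u = 0 := by
  let P := ProjectiveResolution.of (ModuleCat.of R (R ⧸ J))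
  obtain ⟨p, -, h₁⟩ := P.exists_exact_linearMap
  obtain ⟨q, hq, hq0⟩ := exists_ext_presentation P Y 1
  obtain ⟨z, rfl⟩ := hq u
  obtain ⟨h, hh⟩ := exists_comp_eq_smul_id h₁ (r := r)
    (Module.mem_annihilator.1 (by rwa [Ideal.annihilator_quotient]))
  rw [← map_smul, hq0]
  exact ⟨z.1 ∘ₗ h, cocycle_comp_comp_eq_smul (P.function_exact 0) hh (LinearMap.mem_ker.1 z.2)⟩

/-- For a nonzero ideal `J` of a domain `R` with fraction field `K`, the module `Ext¹(R / J, R)`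
embeds into `K / R`. -/
theorem exists_injective_ext_one_quotient_fractionRing {R : Type} [CommRing R] [IsDomain R]
    {J : Ideal R} (hJ : J ≠ ⊥) :
    ∃ g : ((Ext R (ModuleCat.{0} R) 1).obj (Opposite.op (ModuleCat.of R (R ⧸ J)))).obj
        (ModuleCat.of R R) →ₗ[R]
        FractionRing R ⧸ LinearMap.range (Algebra.linearMap R (FractionRing R)),
      Function.Injective g := by
  let P := ProjectiveResolution.of (ModuleCat.of R (R ⧸ J))
  obtain ⟨y, hyJ, hy⟩ := Submodule.exists_mem_ne_zero_of_ne_bot hJ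
  obtain ⟨p, hp, h₁⟩ := P.exists_exact_linearMap
  obtain ⟨q, hq, hq0⟩ := exists_ext_presentation P (ModuleCat.of R R) 1
  obtain ⟨θ, hθ⟩ := exists_cocycle_to_fractionRing_quotient hyJ hy hp h₁ (P.function_exact 0)
  exact LinearMap.exists_injective_of_ker_eq_ker q hq θ (Submodule.ext fun z ↦
    (hq0 z).trans (hθ z).symm)

/-- The lengths of the `x`-torsion submodules of `Ext¹(R / 𝔪ⁿ, R)` are bounded uniformly in `n`. -/
theorem exists_length_torsionBy_ext_one_le (R : Type) [CommRing R] [IsDomain R]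
    [IsNoetherianRing R] [IsLocalRing R] {x : R} (hx0 : x ≠ 0)
    (hx : x ∈ IsLocalRing.maximalIdeal R) :
    ∃ L : ℕ∞, L ≠ ⊤ ∧ ∀ n : ℕ, Module.length R (Submodule.torsionBy R
      (((Ext R (ModuleCat.{0} R) 1).obj (Opposite.op (ModuleCat.of R
        (R ⧸ IsLocalRing.maximalIdeal R ^ n)))).obj (ModuleCat.of R R)) x) ≤ L := by
  obtain ⟨T, hT, hmem⟩ := exists_finite_submodule_fractionRing_quotient R hx0
  have : IsArtinian R T := isArtinian_of_forall_maximalIdeal_pow_smul_eq_zero fun t ↦ by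
    obtain ⟨-, n, hn⟩ := (hmem t).1 t.2
    exact ⟨n, fun r hr ↦ Subtype.ext (hn r hr)⟩
  refine ⟨Module.length R T, Module.length_ne_top, fun n ↦ ?_⟩
  obtain ⟨g, hg⟩ := exists_injective_ext_one_quotient_fractionRing
    (J := IsLocalRing.maximalIdeal R ^ n)
    (pow_ne_zero n fun h ↦ hx0 (by rwa [h] at hx))
  refine Module.length_le_of_injective ((g ∘ₗ Submodule.subtype _).codRestrict T fun u ↦ ?_) ?_
  · refine (hmem _).2 ⟨?_, n, fun r hr ↦ ?_⟩
    · rw [LinearMap.comp_apply, ← map_smul]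
      exact (congrArg g u.2).trans (map_zero g)
    · rw [LinearMap.comp_apply, ← map_smul]
      exact (congrArg g (smul_ext_one_quotient_eq_zero hr _)).trans (map_zero g)
  · intro a b hab
    exact Subtype.ext (hg (congrArg Subtype.val hab))

/-- The terms of the complex `0 → R → R → 0`. -/
def mulComplexX (R : Type) [CommRing R] : ℕ → ModuleCat.{0} R
  | 0 => ModuleCat.of R R
  | 1 => ModuleCat.of R R
  | _ + 2 => ModuleCat.of R PUnit

/-- The differentials of the complex `0 → R → R → 0` given by multiplication by `x`. -/
def mulComplexD {R : Type} [CommRing R] (x : R) :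
    ∀ n : ℕ, mulComplexX R (n + 1) ⟶ mulComplexX R n
  | 0 => ModuleCat.ofHom (LinearMap.lsmul R R x)
  | _ + 1 => 0

/-- The complex `0 → R → R → 0` given by multiplication by `x`. -/
def mulComplex {R : Type} [CommRing R] (x : R) : ChainComplex (ModuleCat.{0} R) ℕ :=
  ChainComplex.of (mulComplexX R) (mulComplexD x) fun _ ↦ Limits.zero_comp

theorem mulComplex_d_one_zero {R : Type} [CommRing R] (x : R) :
    (mulComplex x).d 1 0 = ModuleCat.ofHom (LinearMap.lsmul R R x) :=
  ChainComplex.of_d (mulComplexX R) (mulComplexD x) 0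

theorem mulComplex_d_one_zero_apply {R : Type} [CommRing R] (x r : R) :
    ((mulComplex x).d 1 0).hom r = x * r :=
  congrArg (fun f : ModuleCat.of R R ⟶ ModuleCat.of R R ↦ f.hom r) (mulComplex_d_one_zero x)

theorem mulComplex_d_comp_mkQ {R : Type} [CommRing R] (x : R) :
    (mulComplex x).d 1 0 ≫ ModuleCat.ofHom (Submodule.mkQ (Ideal.span {x})) = 0 := by
  refine ModuleCat.hom_ext (LinearMap.ext fun r ↦ ?_)
  refine (congrArg (Submodule.mkQ (Ideal.span {x})) (mulComplex_d_one_zero_apply x r)).trans ?_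
  exact Ideal.Quotient.eq_zero_iff_mem.2
    (Ideal.mul_mem_right _ _ (Ideal.mem_span_singleton_self x))

/-- The resolution `0 → R → R → R / (x) → 0` for a nonzerodivisor `x`. -/
def mulResolution {R : Type} [CommRing R] [IsDomain R] {x : R} (hx : x ≠ 0) :
    ProjectiveResolution (ModuleCat.of R (R ⧸ Ideal.span {x})) where
  complex := mulComplex x
  projective n := by
    rw [← IsProjective.iff_projective]
    obtain (_ | _ | n) := n
    · exact inferInstanceAs (Module.Projective R R)
    · exact inferInstanceAs (Module.Projective R R)
    · exact inferInstanceAs (Module.Projective R PUnit)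
  π := (ChainComplex.toSingle₀Equiv _ _).symm
    ⟨ModuleCat.ofHom (Submodule.mkQ (Ideal.span {x})), mulComplex_d_comp_mkQ x⟩
  quasiIso := ⟨fun n ↦ by
    obtain (_ | _ | n) := n
    · rw [ChainComplex.quasiIsoAt₀_iff, ShortComplex.quasiIso_iff_of_zeros']
      · refine (ShortComplex.exact_and_epi_g_iff_of_iso
          (S₂ := ShortComplex.mk ((mulComplex x).d 1 0)
            (ModuleCat.ofHom (Submodule.mkQ (Ideal.span {x}))) (mulComplex_d_comp_mkQ x)) ?_).2
          ⟨?_, ?_⟩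
        · exact ShortComplex.isoMk (Iso.refl _) (Iso.refl _) (Iso.refl _)
            ((Category.id_comp _).trans (Category.comp_id _).symm)
            ((Category.id_comp _).trans (Eq.trans
              (ChainComplex.toSingle₀Equiv_symm_apply_f_zero _ (mulComplex_d_comp_mkQ x)).symm
              (Category.comp_id _).symm))
        · rw [ShortComplex.ShortExact.moduleCat_exact_iff_function_exact]
          intro r
          refine Ideal.Quotient.eq_zero_iff_mem.trans (Ideal.mem_span_singleton'.trans ?_)
          refine exists_congr fun a ↦ ?_
          rw [mul_comm]
          exact (mulComplex_d_one_zero_apply x a).congr_left.symm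
        · exact (ModuleCat.epi_iff_surjective _).2 (Submodule.mkQ_surjective _)
      all_goals rfl
    · rw [quasiIsoAt_iff_exactAt']
      · rw [HomologicalComplex.exactAt_iff' _ 2 1 0 (by simp) (by simp),
          ShortComplex.ShortExact.moduleCat_exact_iff_function_exact]
        intro r
        refine ⟨fun hr ↦ ⟨0, ?_⟩, ?_⟩
        · exact ((mul_eq_zero.1 ((mulComplex_d_one_zero_apply x r).symm.trans hr)).resolve_left
            hx).symm
        · rintro ⟨u, rfl⟩
          have : u = 0 := Subsingleton.elim (α := PUnit) u 0
          rw [this]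
          exact ((congrArg _ (map_zero _)).trans (map_zero _))
      · apply ChainComplex.exactAt_succ_single_obj
    · rw [quasiIsoAt_iff_exactAt']
      · rw [HomologicalComplex.exactAt_iff' _ (n + 3) (n + 2) (n + 1) (by simp) (by simp)]
        exact ShortComplex.exact_of_isZero_X₂ _ (ModuleCat.isZero_of_iff_subsingleton.2
          (inferInstanceAs (Subsingleton PUnit)))
      · apply ChainComplex.exactAt_succ_single_obj⟩

/-- For a nonzero `x` in a domain `R`, the module `R / (x)` has a projective resolution
`0 → R → R` given by multiplication by `x`. -/
theorem exists_projectiveResolution_quotient_span_singleton {R : Type} [CommRing R] [IsDomain R]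
    {x : R} (hx : x ≠ 0) :
    ∃ (P : ProjectiveResolution (ModuleCat.of R (R ⧸ Ideal.span {x})))
      (e₀ : R ≃ₗ[R] P.complex.X 0) (e₁ : R ≃ₗ[R] P.complex.X 1),
      (∀ r, (P.complex.d 1 0).hom (e₁ r) = e₀ (x * r)) ∧ ∀ n, Subsingleton (P.complex.X (n + 2)) :=
  ⟨mulResolution hx, LinearEquiv.refl R R, LinearEquiv.refl R R, mulComplex_d_one_zero_apply x,
    fun _ ↦ inferInstanceAs (Subsingleton PUnit)⟩

/-- If the kernel and cokernel of `x` on `M` are Noetherian and finitely generated, respectively,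
then all `Extⁱ(R / (x), M)` are finitely generated. -/
theorem finite_ext_quotient_span_singleton {R : Type} [CommRing R] [IsDomain R]
    {x : R} (hx : x ≠ 0) (M : ModuleCat.{0} R) [IsNoetherian R (Submodule.torsionBy R M x)]
    [Module.Finite R (M ⧸ LinearMap.range (LinearMap.lsmul R M x))] (i : ℕ) :
    Module.Finite R
      (((Ext R (ModuleCat.{0} R) i).obj
        (Opposite.op (ModuleCat.of R (R ⧸ Ideal.span {x})))).obj M) := by
  obtain ⟨P, e₀, e₁, hd, hP⟩ := exists_projectiveResolution_quotient_span_singleton hx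
  obtain ⟨q, hq, hq0⟩ := exists_ext_presentation P M i
  obtain (_ | _ | i) := i
  · let f : LinearMap.ker (LinearMap.lcomp R M (P.complex.d 1 0).hom) →ₗ[R]
        Submodule.torsionBy R M x :=
      (LinearMap.applyₗ (e₀ 1) ∘ₗ Submodule.subtype _).codRestrict _ fun z ↦ by
        have := LinearMap.congr_fun (LinearMap.mem_ker.1 z.2) (e₁ 1)
        rw [LinearMap.lcomp_apply, hd, ← smul_eq_mul, map_smul, map_smul] at this
        exact this
    have := isNoetherian_of_injective f (fun z w h ↦ Subtype.ext
      ((LinearMap.cancel_right e₀.surjective).1 (LinearMap.ext_ring (congrArg Subtype.val h))))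
    exact Module.Finite.of_surjective q hq
  · let c : M →ₗ[R] LinearMap.ker (LinearMap.lcomp R M (P.complex.d 2 1).hom) :=
      (LinearMap.lcomp R M e₁.symm.toLinearMap ∘ₗ
        (LinearMap.ringLmapEquivSelf R R M).symm.toLinearMap).codRestrict _ fun m ↦ by
        have := hP 0
        exact LinearMap.ext fun v ↦ by rw [Subsingleton.elim v 0, map_zero, map_zero]
    have hc (m : M) : (c m).1 (e₁ 1) = m := by
      change (LinearMap.ringLmapEquivSelf R R M).symm m (e₁.symm (e₁ 1)) = m
      rw [LinearEquiv.symm_apply_apply]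
      exact one_smul R m
    refine Module.Finite.of_surjective
      ((LinearMap.range (LinearMap.lsmul R M x)).liftQ (q ∘ₗ c) ?_) ?_
    · rintro _ ⟨m, rfl⟩
      refine (hq0 _).2 ⟨(LinearMap.ringLmapEquivSelf R R M).symm m ∘ₗ e₀.symm.toLinearMap, ?_⟩
      refine (LinearMap.cancel_right e₁.surjective).1 (LinearMap.ext_ring ?_)
      change (LinearMap.ringLmapEquivSelf R R M).symm m
        (e₀.symm ((P.complex.d 1 0).hom (e₁ 1))) = (c (x • m)).1 (e₁ 1)
      rw [hc, hd, LinearEquiv.symm_apply_apply, mul_one]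
      rfl
    · refine fun u ↦ ?_
      obtain ⟨z, rfl⟩ := hq u
      refine ⟨Submodule.Quotient.mk (z.1 (e₁ 1)), congrArg q (Subtype.ext ?_)⟩
      refine (LinearMap.cancel_right e₁.surjective).1 (LinearMap.ext_ring ?_)
      exact hc _
  · have := hP i
    have : Subsingleton (LinearMap.ker (LinearMap.lcomp R M (P.complex.d (i + 3) (i + 2)).hom)) :=
      ⟨fun z w ↦ Subtype.ext (LinearMap.ext fun v ↦ by
        rw [Subsingleton.elim v 0, map_zero, map_zero])⟩
    exact Module.Finite.of_surjective q hq

/-- Local cohomology as a directed union of images of `Ext` modules. -/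
theorem exists_ext_to_localCohomology {R : Type} [CommRing R] (J : Ideal R) (i : ℕ)
    (Y : ModuleCat.{0} R) :
    ∃ ι : ∀ n : ℕ, ((Ext R (ModuleCat.{0} R) i).obj
        (Opposite.op (ModuleCat.of R (R ⧸ J ^ n)))).obj Y →ₗ[R] (localCohomology J i).obj Y,
      (∀ t, ∃ n u, ι n u = t) ∧
      (∀ n k, n ≤ k → ∃ τ, ι k ∘ₗ τ = ι n) ∧
      ∀ n u, ι n u = 0 → ∃ k τ, ι k ∘ₗ τ = ι n ∧ τ u = 0 := by
  let D := localCohomology.diagram (localCohomology.idealPowersDiagram J) i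
  let F := D ⋙ (evaluation (ModuleCat.{0} R) (ModuleCat.{0} R)).obj Y
  let c : Limits.Cocone F :=
    ((evaluation (ModuleCat.{0} R) (ModuleCat.{0} R)).obj Y).mapCocone (Limits.colimit.cocone D)
  have hc : Limits.IsColimit c :=
    Limits.isColimitOfPreserves _ (Limits.colimit.isColimit D)
  refine ⟨fun n ↦ (c.ι.app (.op (.op n))).hom, fun t ↦ ?_, fun n k h ↦ ?_, fun n u hu ↦ ?_⟩
  · obtain ⟨j, u, hu⟩ := Limits.Concrete.isColimit_exists_rep F hc t
    exact ⟨_, u, hu⟩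
  · refine ⟨(F.map (homOfLE h).op.op).hom, ?_⟩
    exact congrArg ModuleCat.Hom.hom (c.w (homOfLE h).op.op)
  · let j : ℕᵒᵖᵒᵖ := .op (.op n)
    have h0 : c.ι.app j (0 : F.obj j) = 0 := map_zero (c.ι.app j).hom
    obtain ⟨k, f, g, h⟩ := (Limits.Concrete.isColimit_rep_eq_iff_exists F hc
      (i := j) (j := j) u (0 : F.obj j)).1 (hu.trans h0.symm)
    exact ⟨k.unop.unop, (F.map f).hom, congrArg ModuleCat.Hom.hom (c.w f),
      h.trans (map_zero (F.map g).hom)⟩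

/-- Every element of `H¹_J(Y)` is annihilated by a power of `J`. -/
theorem exists_forall_mem_pow_smul_localCohomology_one_eq_zero {R : Type} [CommRing R] (J : Ideal R)
    (Y : ModuleCat.{0} R) (t : (localCohomology J 1).obj Y) :
    ∃ n : ℕ, ∀ r ∈ J ^ n, r • t = 0 := by
  obtain ⟨ι, hι, -, -⟩ := exists_ext_to_localCohomology J 1 Y
  obtain ⟨n, u, rfl⟩ := hι t
  exact ⟨n, fun r hr ↦ by rw [← map_smul, smul_ext_one_quotient_eq_zero hr, map_zero]⟩

/-- The kernel of `x` on `H¹_𝔪(R)` has finite length. -/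
theorem isFiniteLength_torsionBy_localCohomology_one (R : Type) [CommRing R] [IsDomain R]
    [IsNoetherianRing R] [IsLocalRing R] {x : R} (hx0 : x ≠ 0)
    (hx : x ∈ IsLocalRing.maximalIdeal R) :
    IsFiniteLength R (Submodule.torsionBy R
      ((localCohomology (IsLocalRing.maximalIdeal R) 1).obj (ModuleCat.of R R)) x) := by
  obtain ⟨ι, hι, hmono, hker⟩ :=
    exists_ext_to_localCohomology (IsLocalRing.maximalIdeal R) 1 (ModuleCat.of R R)
  obtain ⟨L, hL, hlen⟩ := exists_length_torsionBy_ext_one_le R hx0 hx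
  let f (n : ℕ) := (ι n).restrict (p := Submodule.torsionBy R _ x)
    (q := Submodule.torsionBy R _ x) fun u hu ↦ by
      rw [Submodule.mem_torsionBy_iff] at hu ⊢
      rw [← map_smul, hu, map_zero]
  refine isFiniteLength_of_monotone_iUnion (fun n ↦ LinearMap.range (f n)) ?_ ?_ hL fun n ↦
    (Module.length_le_of_surjective _ (f n).surjective_rangeRestrict).trans (hlen n)
  · rintro n k h _ ⟨u, rfl⟩
    obtain ⟨τ, hτ⟩ := hmono n k h
    refine ⟨⟨τ u, ?_⟩, Subtype.ext (LinearMap.congr_fun hτ u)⟩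
    rw [Submodule.mem_torsionBy_iff, ← map_smul]
    exact (congrArg τ u.2).trans (map_zero τ)
  · rintro ⟨t, ht⟩
    obtain ⟨n, u, rfl⟩ := hι t
    obtain ⟨k, τ, hτ, hu⟩ := hker n (x • u) (by
      rw [map_smul]; exact ht)
    exact ⟨k, ⟨τ u, by rwa [Submodule.mem_torsionBy_iff, ← map_smul]⟩,
      Subtype.ext (LinearMap.congr_fun hτ u)⟩

/-- If `(R, 𝔪)` is a Noetherian local domain of dimension at least `1` and `x ∈ 𝔪` is
nonzero, then `H^1_𝔪(R)` is `Rx`-cofinite. -/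
theorem localCohomology_isCofinite (R : Type) [CommRing R] [IsDomain R]
    [IsNoetherianRing R] [IsLocalRing R] (hdim : 1 ≤ ringKrullDim R)
    (x : R) (hx0 : x ≠ 0) (hx : x ∈ IsLocalRing.maximalIdeal R) :
    IsCofinite R (Ideal.span {x})
      ((localCohomology (IsLocalRing.maximalIdeal R) 1).obj (ModuleCat.of R R)) := by
  have htors (t : (localCohomology (IsLocalRing.maximalIdeal R) 1).obj (ModuleCat.of R R)) :
      ∃ n : ℕ, x ^ n • t = 0 := by
    obtain ⟨n, hn⟩ := exists_forall_mem_pow_smul_localCohomology_one_eq_zero _ _ t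
    exact ⟨n, hn _ (Ideal.pow_mem_pow hx n)⟩
  refine ⟨fun p hp ↦ ?_, fun i ↦ ?_⟩
  · obtain ⟨t, ht⟩ := Module.mem_support_iff_exists_annihilator.1 hp
    obtain ⟨n, hn⟩ := htors t
    have hxp : x ∈ p.asIdeal := p.isPrime.mem_of_pow_mem n
      (ht ((Submodule.mem_annihilator_span_singleton t _).2 hn))
    exact Ideal.span_le.2 (Set.singleton_subset_iff.2 hxp)
  · obtain ⟨_, _⟩ := isFiniteLength_iff_isNoetherian_isArtinian.1
      (isFiniteLength_torsionBy_localCohomology_one R hx0 hx)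
    have := finite_quotient_range_lsmul x htors
    exact finite_ext_quotient_span_singleton hx0 _ i
end
end
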